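/- arXiv:2411.08239 — 8 statements merged into one kernel-verified Lean document; each statement's English description precedes it below -/
import Mathlib

section
/- For every j ∈ {1,…,n}, the vector x_j satisfies A(α)·x_j = ν_j(α)·x_j; that is, x_j is an eigenvector of the non-persymmetric Toeplitz-minus-Hankel matrix A(α) = T^{(α,m)} − H^{(α,m)} with eigenvalue ν_j(α) = α_0 + 2·Σ_{l=1}^{m} α_l·cos(l·j·π·h). -/
open Real Matrix

theorem sum_Icc_mul_indicator (m d : ℕ) (α : ℕ → ℝ) (hd : 1 ≤ d) :
    ∑ l ∈ Finset.Icc 1 m, α l * (if l = d then 1 else 0) = if d ≤ m then α d else 0 := by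
  simp [Finset.sum_ite_eq', hd]

/-- A banded Toeplitz entry as a sum of its off-diagonal contributions. -/
theorem toeplitz_entry_eq_sum (m r c : ℕ) (α : ℕ → ℝ) :
    (if ((r : ℤ) - (c : ℤ)).natAbs ≤ m then α ((r : ℤ) - (c : ℤ)).natAbs else 0) =
      (if c = r then α 0 else 0) + ∑ l ∈ Finset.Icc 1 m,
        α l * ((if c = r + l then 1 else 0) + (if c + l = r then 1 else 0)) := by
  rcases lt_trichotomy c r with hlt | rfl | hlt
  · have hd : ((r : ℤ) - (c : ℤ)).natAbs = r - c := by omega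
    rw [hd, if_neg hlt.ne, zero_add, ← sum_Icc_mul_indicator m (r - c) α (by omega)]
    refine Finset.sum_congr rfl fun l _ => ?_
    rw [if_neg (show ¬c = r + l by omega), zero_add]
    simp only [show (c + l = r) ↔ (l = r - c) by omega]
  · have hz : ∀ l ∈ Finset.Icc 1 m,
        α l * ((if c = c + l then 1 else 0) + (if c + l = c then 1 else 0)) = 0 := by
      intro l hl
      have := (Finset.mem_Icc.mp hl).1
      rw [if_neg (by omega), if_neg (by omega)]
      simp
    rw [Finset.sum_eq_zero hz]
    simp
  · have hd : ((r : ℤ) - (c : ℤ)).natAbs = c - r := by omega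
    rw [hd, if_neg hlt.ne', zero_add, ← sum_Icc_mul_indicator m (c - r) α (by omega)]
    refine Finset.sum_congr rfl fun l _ => ?_
    rw [if_neg (show ¬c + l = r by omega), add_zero]
    simp only [show (c = r + l) ↔ (l = c - r) by omega]

/-- A sequence that is odd about `n` is recovered beyond `n` by reflection. -/
theorem sum_indicator_reflect_right (n p : ℕ) (s : ℤ → ℝ) (hs : ∀ k, s (2 * n - k) = -s k)
    (hp : p ≤ 2 * n) :
    ∑ c : Fin n, ((if (c : ℕ) = p then 1 else 0) - (if (c : ℕ) + p = 2 * n then 1 else 0)) * s c =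
      s p := by
  rw [Fin.sum_univ_eq_sum_range (fun c : ℕ =>
    ((if c = p then 1 else 0) - (if c + p = 2 * n then 1 else 0)) * s c) n]
  rcases lt_trichotomy p n with hlt | rfl | hlt
  · rw [Finset.sum_eq_single_of_mem p (Finset.mem_range.mpr hlt)]
    · rw [if_pos rfl, if_neg (by omega)]
      ring
    · intro c hc hcp
      have := Finset.mem_range.mp hc
      rw [if_neg hcp, if_neg (by omega)]
      ring
  · have h0 : s p = 0 := by
      have := hs p
      rw [show (2 * p - p : ℤ) = p by ring] at this
      linarith
    rw [h0]
    refine Finset.sum_eq_zero fun c hc => ?_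
    have := Finset.mem_range.mp hc
    rw [if_neg (by omega), if_neg (by omega)]
    ring
  · rw [Finset.sum_eq_single_of_mem (2 * n - p) (Finset.mem_range.mpr (by omega))]
    · rw [if_neg (by omega), if_pos (by omega)]
      have := hs p
      rw [Nat.cast_sub hp]
      push_cast
      rw [this]
      ring
    · intro c hc hcp
      have := Finset.mem_range.mp hc
      rw [if_neg (by omega), if_neg (by omega)]
      ring

/-- A sequence that is odd about `-1/2` is recovered at negative indices by reflection. -/
theorem sum_indicator_reflect_left (n r l : ℕ) (s : ℤ → ℝ) (hs : ∀ k, s (-1 - k) = -s k)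
    (hr : r < n) (hl : l ≤ n) :
    ∑ c : Fin n, ((if (c : ℕ) + l = r then 1 else 0) - (if l = r + c + 1 then 1 else 0)) * s c =
      s (r - l) := by
  rw [Fin.sum_univ_eq_sum_range (fun c : ℕ =>
    ((if c + l = r then 1 else 0) - (if l = r + c + 1 then 1 else 0)) * s c) n]
  rcases le_or_gt l r with hlr | hlr
  · rw [Finset.sum_eq_single_of_mem (r - l) (Finset.mem_range.mpr (by omega))]
    · rw [if_pos (by omega), if_neg (by omega), Nat.cast_sub hlr]
      ring
    · intro c hc hcp
      rw [if_neg (by omega), if_neg (by omega)]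
      ring
  · rw [Finset.sum_eq_single_of_mem (l - r - 1) (Finset.mem_range.mpr (by omega))]
    · rw [if_neg (by omega), if_pos (by omega),
        show ((r : ℤ) - l) = -1 - ((l - r - 1 : ℕ) : ℤ) by omega, hs]
      ring
    · intro c hc hcp
      rw [if_neg (by omega), if_neg (by omega)]
      ring

/-- For every `j ∈ {1,…,n}`, the vector `x_j` is an eigenvector of the
non-persymmetric Toeplitz-minus-Hankel matrix `A(α) = T^{(α,m)} − H^{(α,m)}` with
eigenvalue `ν_j(α) = α_0 + 2·Σ_{l=1}^m α_l·cos(l·j·π·h)`, where `h = 2/(2n+1)`.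
Matrix entries are described in 1-based form via 0-based indices `r, c : Fin n`:
1-based row `r+1`, column `c+1`. -/
theorem stmt0 (n m : ℕ) (hn : 2 ≤ n) (hm1 : 1 ≤ m) (hmn : m ≤ n - 1)
    (α : ℕ → ℝ) (h : ℝ) (hh : h = 2 / (2 * n + 1))
    (A : Matrix (Fin n) (Fin n) ℝ)
    (hA : ∀ r c : Fin n, A r c =
      (if ((r : ℤ) - (c : ℤ)).natAbs ≤ m then α ((r : ℤ) - (c : ℤ)).natAbs else 0)
      - (if (r : ℕ) + (c : ℕ) + 1 ≤ m then α ((r : ℕ) + (c : ℕ) + 1) else 0)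
      - (if 2 * n - (r : ℕ) - (c : ℕ) ≤ m then α (2 * n - (r : ℕ) - (c : ℕ)) else 0))
    (x : ℕ → Fin n → ℝ)
    (hx : ∀ (j : ℕ) (k : Fin n), x j k = Real.sin (j * π * ((k : ℝ) + 1 / 2) * h))
    (ν : ℕ → ℝ)
    (hν : ∀ j : ℕ, ν j = α 0 + 2 * ∑ l ∈ Finset.Icc 1 m, α l * Real.cos (l * j * π * h)) :
    ∀ j : ℕ, 1 ≤ j → j ≤ n → A.mulVec (x j) = ν j • x j := by
  intro j _ _
  have hh' : (2 * n + 1 : ℝ) * h = 2 := by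
    rw [hh]
    field_simp
  obtain ⟨s, hs⟩ : ∃ s : ℤ → ℝ, ∀ k, s k = Real.sin (j * π * ((k : ℝ) + 1 / 2) * h) :=
    ⟨_, fun _ => rfl⟩
  have hleft : ∀ k, s (-1 - k) = -s k := by
    intro k
    rw [hs, hs, ← Real.sin_neg]
    congr 1
    push_cast
    ring
  have hright : ∀ k, s (2 * n - k) = -s k := by
    intro k
    rw [hs, hs, ← Real.sin_nat_mul_two_pi_sub _ j]
    congr 1
    push_cast
    linear_combination (j * π) * hh'
  have hxs : ∀ c : Fin n, x j c = s ((c : ℕ) : ℤ) := by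
    intro c
    rw [hx, hs]
    push_cast
    rfl
  have hprod : ∀ r l : ℕ, s ((r + l : ℕ) : ℤ) + s (r - l) =
      2 * Real.cos (l * j * π * h) * s r := by
    intro r l
    rw [hs, hs, hs]
    push_cast
    rw [show j * π * ((r : ℝ) + l + 1 / 2) * h = j * π * ((r : ℝ) + 1 / 2) * h + l * j * π * h by
      ring, show j * π * ((r : ℝ) - l + 1 / 2) * h = j * π * ((r : ℝ) + 1 / 2) * h - l * j * π * h by
      ring, Real.sin_add, Real.sin_sub]
    ring
  have hentry : ∀ r c : Fin n, A r c = (if c = r then α 0 else 0) + ∑ l ∈ Finset.Icc 1 m, α l *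
      (((if (c : ℕ) = r + l then 1 else 0) - (if (c : ℕ) + (r + l) = 2 * n then 1 else 0)) +
        ((if (c : ℕ) + l = r then 1 else 0) - (if l = r + c + 1 then 1 else 0))) := by
    intro r c
    rw [hA, toeplitz_entry_eq_sum, ← sum_Icc_mul_indicator m (r + c + 1) α (by omega),
      ← sum_Icc_mul_indicator m (2 * n - r - c) α (by omega), add_sub_assoc, add_sub_assoc,
      ← Finset.sum_sub_distrib, ← Finset.sum_sub_distrib]
    simp only [← Fin.ext_iff]
    congr 1
    refine Finset.sum_congr rfl fun l _ => ?_
    simp only [show ((c : ℕ) + (r + l) = 2 * n) ↔ (l = 2 * n - r - c) by omega]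
    ring
  funext r
  simp only [Matrix.mulVec, dotProduct, Pi.smul_apply, smul_eq_mul, hentry, hxs, add_mul,
    Finset.sum_add_distrib, hν]
  congr 1
  · simp
  · simp only [Finset.sum_mul, Finset.mul_sum]
    rw [Finset.sum_comm]
    refine Finset.sum_congr rfl fun l hl => ?_
    obtain ⟨hl1, hlm⟩ := Finset.mem_Icc.mp hl
    have h1 := sum_indicator_reflect_right n (r + l) s hright (by omega)
    have h2 := sum_indicator_reflect_left n r l s hleft r.isLt (by omega)
    have h3 := hprod r l
    rw [← h1, ← h2, ← Finset.sum_add_distrib] at h3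
    rw [show 2 * (α l * Real.cos (l * j * π * h)) * s (r : ℕ) =
      α l * (2 * Real.cos (l * j * π * h) * s (r : ℕ)) by ring, ← h3, Finset.mul_sum]
    refine Finset.sum_congr rfl fun c _ => ?_
    ring
end

section
/- Suppose additionally that real numbers β_0, …, β_m are given and that the matrix B(β), built from β by the same construction as A(α), is invertible. Then for every j ∈ {1,…,n} one has ν_j(β) ≠ 0 and A(α)·x_j = (ν_j(α)/ν_j(β))·(B(β)·x_j); that is, (ν_j(α)/ν_j(β), x_j) is an eigenpair of the generalized eigenvalue problem A(α) x = λ B(β) x. -/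
open Real Matrix

lemma sum_Icc_neg_self (m : ℕ) (g : ℤ → ℝ) :
    ∑ d ∈ Finset.Icc (-(m : ℤ)) m, g d = g 0 + ∑ l ∈ Finset.Icc 1 m, (g l + g (-(l : ℤ))) := by
  induction m with
  | zero => simp
  | succ m ih =>
    have hset : Finset.Icc (-((m + 1 : ℕ) : ℤ)) ((m + 1 : ℕ) : ℤ) =
        insert ((m + 1 : ℕ) : ℤ) (insert (-((m + 1 : ℕ) : ℤ)) (Finset.Icc (-(m : ℤ)) m)) := by
      ext d
      simp only [Finset.mem_Icc, Finset.mem_insert]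
      omega
    rw [hset, Finset.sum_insert, Finset.sum_insert, ih, Finset.sum_Icc_succ_top (by omega)]
    · ring
    · simp only [Finset.mem_Icc]; omega
    · simp only [Finset.mem_Icc, Finset.mem_insert]; omega

lemma sum_Icc_neg_two_mul (n : ℕ) (f : ℤ → ℝ) :
    ∑ c ∈ Finset.Icc (-(n : ℤ)) (2 * n), f c =
      ∑ k : Fin n, (f (k : ℕ) + f (-1 - (k : ℕ)) + f (2 * n - (k : ℕ))) + f n := by
  have hshift : ∑ c ∈ Finset.Icc (-(n : ℤ)) (2 * n), f c =
      ∑ i ∈ Finset.range (n + n + 1 + n), f ((i : ℤ) - n) := by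
    refine Finset.sum_nbij' (fun c => (c + n).toNat) (fun i => (i : ℤ) - n) ?_ ?_ ?_ ?_ ?_
    · intro c hc
      simp only [Finset.mem_Icc, Finset.mem_range] at hc ⊢
      omega
    · intro i hi
      simp only [Finset.mem_Icc, Finset.mem_range] at hi ⊢
      omega
    · intro c hc
      simp only [Finset.mem_Icc] at hc
      omega
    · intro i hi
      omega
    · intro c hc
      simp only [Finset.mem_Icc] at hc
      congr 1
      omega
  rw [hshift, Finset.sum_range_add, Finset.sum_range_succ, Finset.sum_range_add,
    Finset.sum_add_distrib, Finset.sum_add_distrib,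
    Fin.sum_univ_eq_sum_range (fun k => f (k : ℕ)),
    Fin.sum_univ_eq_sum_range (fun k => f (-1 - (k : ℕ))),
    Fin.sum_univ_eq_sum_range (fun k => f (2 * n - (k : ℕ))),
    ← Finset.sum_range_reflect (fun k => f (-1 - (k : ℕ))),
    ← Finset.sum_range_reflect (fun k => f (2 * n - (k : ℕ)))]
  have hleft : ∑ i ∈ Finset.range n, f ((i : ℤ) - n) =
      ∑ i ∈ Finset.range n, f (-1 - ((n - 1 - i : ℕ) : ℤ)) := by
    refine Finset.sum_congr rfl fun i hi => congrArg f ?_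
    have := Finset.mem_range.1 hi
    omega
  have hmid : ∑ i ∈ Finset.range n, f (((n + i : ℕ) : ℤ) - n) =
      ∑ i ∈ Finset.range n, f (i : ℕ) := by
    refine Finset.sum_congr rfl fun i _ => congrArg f ?_
    omega
  have hright : ∑ i ∈ Finset.range n, f (((n + n + 1 + i : ℕ) : ℤ) - n) =
      ∑ i ∈ Finset.range n, f (2 * n - ((n - 1 - i : ℕ) : ℤ)) := by
    refine Finset.sum_congr rfl fun i hi => congrArg f ?_
    have := Finset.mem_range.1 hi
    omega
  have hcenter : (((n + n : ℕ) : ℤ) - n) = n := by omega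
  rw [hleft, hmid, hright, hcenter]
  ring

/-- A sequence odd about `-1/2` and about `n` turns the Toeplitz-minus-Hankel action into a
symmetric convolution. -/
lemma sum_toeplitz_sub_hankel_mul {n m : ℕ} (hmn : m < n) (ξ : ℕ → ℝ) (s : ℤ → ℝ)
    (hs : ∀ c, s (-1 - c) = -s c) (hs' : ∀ c, s (2 * n - c) = -s c) (r : Fin n) :
    ∑ c : Fin n, ((if ((r : ℤ) - (c : ℤ)).natAbs ≤ m then ξ ((r : ℤ) - (c : ℤ)).natAbs else 0)
      - (if (r : ℕ) + (c : ℕ) + 1 ≤ m then ξ ((r : ℕ) + (c : ℕ) + 1) else 0)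
      - (if 2 * n - (r : ℕ) - (c : ℕ) ≤ m then ξ (2 * n - (r : ℕ) - (c : ℕ)) else 0))
        * s (c : ℕ) =
    ξ 0 * s (r : ℕ) + ∑ l ∈ Finset.Icc 1 m, ξ l * (s ((r : ℕ) + l) + s ((r : ℕ) - l)) := by
  have hr := r.isLt
  set f : ℤ → ℝ := fun c =>
    (if (((r : ℕ) : ℤ) - c).natAbs ≤ m then ξ (((r : ℕ) : ℤ) - c).natAbs else 0) * s c with hf
  have hn0 : s n = 0 := by
    have := hs' n
    rw [show (2 * (n : ℤ) - n) = n by ring] at this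
    linarith
  have hext := sum_Icc_neg_two_mul n f
  have hfn : f n = 0 := by simp [hf, hn0]
  have hconv : ∑ c ∈ Finset.Icc (-(n : ℤ)) (2 * n), f c =
      ∑ d ∈ Finset.Icc (-(m : ℤ)) m, ξ d.natAbs * s ((r : ℕ) + d) := by
    symm
    refine Finset.sum_of_injOn (fun d => ((r : ℕ) : ℤ) + d) ?_ ?_ ?_ ?_
    · intro a _ b _ hab
      simpa using hab
    · intro d hd
      simp only [Finset.coe_Icc, Set.mem_Icc] at hd ⊢
      omega
    · intro c _ hc
      have : ¬ (((r : ℕ) : ℤ) - c).natAbs ≤ m := by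
        intro hle
        refine hc ⟨c - (r : ℕ), ?_, by simp⟩
        simp only [Finset.coe_Icc, Set.mem_Icc]
        omega
      simp only [hf, if_neg this, zero_mul]
    · intro d hd
      have hd' := Finset.mem_Icc.1 hd
      have habs : (((r : ℕ) : ℤ) - ((r : ℕ) + d)).natAbs = d.natAbs := by omega
      simp only [hf, habs]
      rw [if_pos (by omega)]
  rw [hfn, add_zero, hconv, sum_Icc_neg_self] at hext
  simp only [Int.natAbs_zero, Int.natAbs_neg, Int.natAbs_natCast, add_zero, ← sub_eq_add_neg,
    ← mul_add] at hext
  rw [hext]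
  refine Finset.sum_congr rfl fun c _ => ?_
  have hc := c.isLt
  have hleft : (((r : ℕ) : ℤ) - (-1 - (c : ℕ))).natAbs = r + c + 1 := by omega
  have hright : (((r : ℕ) : ℤ) - (2 * n - (c : ℕ))).natAbs = 2 * n - r - c := by omega
  simp only [hf, hleft, hright, hs, hs']
  ring

/-- With `A(α) = M(α)` and `B(β) = M(β)` built by the same
Toeplitz-minus-Hankel construction, if `B(β)` is invertible then for every
`j ∈ {1,…,n}` one has `ν_j(β) ≠ 0` and `(ν_j(α)/ν_j(β), x_j)` is an eigenpair of
the generalized eigenvalue problem `A(α) x = λ B(β) x`. -/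
theorem stmt1 (n m : ℕ) (hn : 2 ≤ n) (hm1 : 1 ≤ m) (hmn : m ≤ n - 1)
    (α β : ℕ → ℝ) (h : ℝ) (hh : h = 2 / (2 * n + 1))
    (M : (ℕ → ℝ) → Matrix (Fin n) (Fin n) ℝ)
    (hM : ∀ (ξ : ℕ → ℝ) (r c : Fin n), M ξ r c =
      (if ((r : ℤ) - (c : ℤ)).natAbs ≤ m then ξ ((r : ℤ) - (c : ℤ)).natAbs else 0)
      - (if (r : ℕ) + (c : ℕ) + 1 ≤ m then ξ ((r : ℕ) + (c : ℕ) + 1) else 0)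
      - (if 2 * n - (r : ℕ) - (c : ℕ) ≤ m then ξ (2 * n - (r : ℕ) - (c : ℕ)) else 0))
    (x : ℕ → Fin n → ℝ)
    (hx : ∀ (j : ℕ) (k : Fin n), x j k = Real.sin (j * π * ((k : ℝ) + 1 / 2) * h))
    (ν : (ℕ → ℝ) → ℕ → ℝ)
    (hν : ∀ (ξ : ℕ → ℝ) (j : ℕ),
      ν ξ j = ξ 0 + 2 * ∑ l ∈ Finset.Icc 1 m, ξ l * Real.cos (l * j * π * h))
    (hB : Invertible (M β)) :
    ∀ j : ℕ, 1 ≤ j → j ≤ n →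
      ν β j ≠ 0 ∧ (M α).mulVec (x j) = (ν α j / ν β j) • (M β).mulVec (x j) := by
  have hN : (2 * (n : ℝ) + 1) ≠ 0 := by positivity
  have eigen : ∀ (ξ : ℕ → ℝ) (j : ℕ), (M ξ).mulVec (x j) = ν ξ j • x j := by
    intro ξ j
    set s : ℤ → ℝ := fun c => Real.sin (j * π * ((c : ℝ) + 1 / 2) * h) with hs
    have hodd : ∀ c, s (-1 - c) = -s c := by
      intro c
      simp only [hs, ← Real.sin_neg]
      congr 1
      push_cast
      ring
    have hodd' : ∀ c, s (2 * n - c) = -s c := by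
      intro c
      simp only [hs, ← Real.sin_neg]
      rw [← Real.sin_add_nat_mul_two_pi (-(j * π * ((c : ℝ) + 1 / 2) * h)) j]
      congr 1
      push_cast
      rw [hh]
      field_simp
      ring
    ext r
    have hxs : ∀ k : Fin n, x j k = s (k : ℕ) := fun k => by simp [hx, hs]
    simp only [Matrix.mulVec, dotProduct, hM, hxs, Pi.smul_apply, smul_eq_mul]
    rw [sum_toeplitz_sub_hankel_mul (by omega) ξ s hodd hodd' r, hν, add_mul, mul_assoc,
      Finset.sum_mul, Finset.mul_sum]
    congr 1
    refine Finset.sum_congr rfl fun l _ => ?_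
    have hplus : (j * π * ((((r : ℕ) : ℤ) + (l : ℤ) : ℤ) + 1 / 2 : ℝ) * h) =
        j * π * ((r : ℕ) + 1 / 2) * h + l * j * π * h := by
      push_cast
      ring
    have hminus : (j * π * ((((r : ℕ) : ℤ) - (l : ℤ) : ℤ) + 1 / 2 : ℝ) * h) =
        j * π * ((r : ℕ) + 1 / 2) * h - l * j * π * h := by
      push_cast
      ring
    simp only [hs, hplus, hminus, Real.sin_add, Real.sin_sub, Int.cast_natCast]
    ring
  intro j hj1 hjn
  have hne : ν β j ≠ 0 := by
    intro h0
    have hker : (M β).mulVec (x j) = 0 := by rw [eigen, h0, zero_smul]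
    have hx0 : x j = 0 := by
      have := congrArg (⅟(M β)).mulVec hker
      simpa [Matrix.mulVec_mulVec] using this
    have hpos : 0 < x j ⟨0, by omega⟩ := by
      have hj1' : (1 : ℝ) ≤ j := by exact_mod_cast hj1
      have hjn' : (j : ℝ) ≤ n := by exact_mod_cast hjn
      have harg : (j * π * (((0 : ℕ) : ℝ) + 1 / 2) * h) = π * (j / (2 * n + 1)) := by
        rw [hh]
        push_cast
        field_simp
        ring
      rw [hx, harg]
      apply Real.sin_pos_of_pos_of_lt_pi
      · positivity
      · have : (j : ℝ) / (2 * n + 1) < 1 := by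
          rw [div_lt_one (by positivity)]
          linarith
        nlinarith [Real.pi_pos]
    rw [hx0] at hpos
    exact lt_irrefl _ hpos
  refine ⟨hne, ?_⟩
  rw [eigen, eigen, smul_smul, div_mul_cancel₀ _ hne]
end

section
/- The determinant of A(α) equals the product of the n values ν_j(α): det A(α) = Π_{j=1}^{n} ( α_0 + 2·Σ_{l=1}^{m} α_l·cos(l·j·π·h) ). -/
open Real Matrix

/-- The banded Toeplitz-minus-Hankel matrix with symbol coefficients `α 0, …, α m`, indexed from
zero. -/
def toeplitzSubHankel (n m : ℕ) (α : ℕ → ℝ) : Matrix (Fin n) (Fin n) ℝ := fun r c =>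
  (if ((r : ℤ) - (c : ℤ)).natAbs ≤ m then α ((r : ℤ) - (c : ℤ)).natAbs else 0)
    - (if (r : ℕ) + (c : ℕ) + 1 ≤ m then α ((r : ℕ) + (c : ℕ) + 1) else 0)
    - (if 2 * n - (r : ℕ) - (c : ℕ) ≤ m then α (2 * n - (r : ℕ) - (c : ℕ)) else 0)

/-- A symmetric banded convolution, written as a sum over a window containing the band. -/
lemma sum_range_band {n m r : ℕ} (hmn : m < n) (hr : r < n) (α : ℕ → ℝ) (s : ℤ → ℝ) :
    ∑ i ∈ Finset.range (n + n + 1 + n),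
        (if ((i : ℤ) - n - r).natAbs ≤ m then α ((i : ℤ) - n - r).natAbs else 0) * s (i - n)
      = α 0 * s r + ∑ l ∈ Finset.range m, α (l + 1) * (s (r - (l + 1)) + s (r + (l + 1))) := by
  have hsplit : n + n + 1 + n = (n + r - m) + (m + 1 + m) + (2 * n - r - m) := by omega
  rw [hsplit, Finset.sum_range_add, Finset.sum_range_add, Finset.sum_range_add _ (m + 1) m,
    Finset.sum_range_succ, Finset.sum_eq_zero (s := Finset.range (n + r - m)),
    Finset.sum_eq_zero (s := Finset.range (2 * n - r - m)),
    ← Finset.sum_range_reflect _ m]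
  · have h1 : ∀ l ∈ Finset.range m,
        (if (((n + r - m + (m - 1 - l) : ℕ) : ℤ) - n - r).natAbs ≤ m then
          α (((n + r - m + (m - 1 - l) : ℕ) : ℤ) - n - r).natAbs else 0)
            * s (((n + r - m + (m - 1 - l) : ℕ) : ℤ) - n) = α (l + 1) * s (r - (l + 1)) := by
      intro l hl
      rw [Finset.mem_range] at hl
      have e1 : (((n + r - m + (m - 1 - l) : ℕ) : ℤ) - n - r).natAbs = l + 1 := by omega
      have e2 : ((n + r - m + (m - 1 - l) : ℕ) : ℤ) - n = r - (l + 1) := by omega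
      rw [e1, e2, if_pos (by omega)]
    have h2 : ∀ l ∈ Finset.range m,
        (if (((n + r - m + (m + 1 + l) : ℕ) : ℤ) - n - r).natAbs ≤ m then
          α (((n + r - m + (m + 1 + l) : ℕ) : ℤ) - n - r).natAbs else 0)
            * s (((n + r - m + (m + 1 + l) : ℕ) : ℤ) - n) = α (l + 1) * s (r + (l + 1)) := by
      intro l hl
      rw [Finset.mem_range] at hl
      have e1 : (((n + r - m + (m + 1 + l) : ℕ) : ℤ) - n - r).natAbs = l + 1 := by omega
      have e2 : ((n + r - m + (m + 1 + l) : ℕ) : ℤ) - n = r + (l + 1) := by omega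
      rw [e1, e2, if_pos (by omega)]
    have e1 : (((n + r - m + m : ℕ) : ℤ) - n - r).natAbs = 0 := by omega
    have e2 : ((n + r - m + m : ℕ) : ℤ) - n = r := by omega
    rw [Finset.sum_congr rfl h1, Finset.sum_congr rfl h2, e1, e2, if_pos (Nat.zero_le m)]
    simp only [mul_add, Finset.sum_add_distrib]
    ring
  · intro i _
    rw [if_neg (by omega), zero_mul]
  · intro i hi
    rw [Finset.mem_range] at hi
    rw [if_neg (by omega), zero_mul]

/-- Reflecting an odd extension turns the action of the matrix into a banded convolution. -/
lemma toeplitzSubHankel_mulVec {n m : ℕ} (hmn : m < n) (α : ℕ → ℝ) (s : ℤ → ℝ)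
    (hleft : ∀ k, s (-1 - k) = -s k) (hright : ∀ k, s (2 * n - k) = -s k) (r : Fin n) :
    (toeplitzSubHankel n m α *ᵥ fun c => s (c : ℕ)) r
      = α 0 * s (r : ℕ)
        + ∑ l ∈ Finset.range m, α (l + 1) * (s ((r : ℕ) - (l + 1)) + s ((r : ℕ) + (l + 1))) := by
  have hr := r.isLt
  have hmid : s n = 0 := by
    have := hright n
    rw [show (2 * n - n : ℤ) = n by ring] at this
    linarith
  rw [← sum_range_band hmn hr, Finset.sum_range_add, Finset.sum_range_succ, Finset.sum_range_add,
    ← Finset.sum_range_reflect _ n,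
    ← Finset.sum_range_reflect (fun x => (if (((n + n + 1 + x : ℕ) : ℤ) - n - (r : ℕ)).natAbs ≤ m
      then α (((n + n + 1 + x : ℕ) : ℤ) - n - (r : ℕ)).natAbs else 0)
        * s (((n + n + 1 + x : ℕ) : ℤ) - n)) n,
    show (((n + n : ℕ) : ℤ) - n) = n by omega, hmid, mul_zero, add_zero,
    ← Finset.sum_add_distrib, ← Finset.sum_add_distrib, mulVec, dotProduct,
    ← Fin.sum_univ_eq_sum_range (fun i => _ + _ + _)]
  refine Finset.sum_congr rfl fun c _ => ?_
  have hc := c.isLt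
  have e1 : ((n - 1 - c : ℕ) : ℤ) - n = -1 - (c : ℕ) := by omega
  have e2 : ((n + c : ℕ) : ℤ) - n = (c : ℕ) := by omega
  have e3 : ((n + n + 1 + (n - 1 - c) : ℕ) : ℤ) - n = 2 * n - (c : ℕ) := by omega
  have f1 : ((-1 - (c : ℕ) : ℤ) - (r : ℕ)).natAbs = r + c + 1 := by omega
  have f2 : (((c : ℕ) : ℤ) - (r : ℕ)).natAbs = ((r : ℤ) - (c : ℤ)).natAbs := by omega
  have f3 : ((2 * n - (c : ℕ) : ℤ) - (r : ℕ)).natAbs = 2 * n - r - c := by omega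
  rw [e1, e2, e3, f1, f2, f3, hleft, hright, toeplitzSubHankel]
  ring

lemma toeplitzSubHankel_mulVec_sin {n m : ℕ} (hmn : m < n) (α : ℕ → ℝ) (j : ℕ) {θ : ℝ}
    (hθ : (2 * n + 1) * θ = 2 * j * π) :
    (toeplitzSubHankel n m α *ᵥ fun c => sin (((c : ℕ) + 1 / 2) * θ))
      = (α 0 + 2 * ∑ l ∈ Finset.Icc 1 m, α l * cos (l * θ)) •
        fun c : Fin n => sin (((c : ℕ) + 1 / 2) * θ) := by
  ext r
  have h := toeplitzSubHankel_mulVec hmn α (fun k : ℤ => sin ((k + 1 / 2) * θ))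
    (fun k => by
      rw [← sin_neg]
      congr 1
      push_cast
      ring)
    (fun k => by
      rw [← sin_neg, ← sin_add_nat_mul_two_pi (-((k + 1 / 2) * θ)) j]
      congr 1
      push_cast
      linear_combination hθ) r
  simp only [Int.cast_natCast] at h
  rw [h, Pi.smul_apply, smul_eq_mul, add_mul (α 0), ← Finset.Ico_add_one_right_eq_Icc,
    Finset.sum_Ico_eq_sum_range, Nat.add_sub_cancel, Finset.mul_sum, Finset.sum_mul]
  congr 1
  refine Finset.sum_congr rfl fun l _ => ?_
  push_cast
  rw [show ((r : ℕ) - ((l : ℝ) + 1) + 1 / 2) * θ = ((r : ℕ) + 1 / 2) * θ - (1 + l) * θ by ring,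
    show ((r : ℕ) + ((l : ℝ) + 1) + 1 / 2) * θ = ((r : ℕ) + 1 / 2) * θ + (1 + l) * θ by ring,
    sin_sub, sin_add, add_comm l 1]
  ring

/-- The discrete sine vectors at frequencies `2jπ/(2n+1)`, `1 ≤ j ≤ n`, are linearly independent,
being eigenvectors of a tridiagonal matrix with distinct eigenvalues. -/
lemma linearIndependent_sin {n : ℕ} (hn : 1 < n) :
    LinearIndependent ℝ fun j c : Fin n =>
      sin (((c : ℕ) + 1 / 2) * (2 * ((j : ℕ) + 1 : ℕ) * π / (2 * n + 1))) := by
  have hpos : (0 : ℝ) < 2 * n + 1 := by positivity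
  have hθ0 : ∀ j : Fin n, 0 < 2 * (((j : ℕ) + 1 : ℕ) : ℝ) * π / (2 * n + 1) := fun j => by
    have := pi_pos
    positivity
  have hθπ : ∀ j : Fin n, 2 * (((j : ℕ) + 1 : ℕ) : ℝ) * π / (2 * n + 1) < π := fun j => by
    have hj : (((j : ℕ) + 1 : ℕ) : ℝ) ≤ n := by exact_mod_cast j.isLt
    rw [div_lt_iff₀ hpos]
    nlinarith [pi_pos]
  refine Module.End.eigenvectors_linearIndependent'
    (toLin' (toeplitzSubHankel n 1 fun _ => 1))
    (fun j : Fin n => 1 + 2 * cos (2 * ((j : ℕ) + 1 : ℕ) * π / (2 * n + 1))) ?_ _ fun j => ⟨?_, ?_⟩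
  · intro i j hij
    have h := injOn_cos ⟨(hθ0 i).le, (hθπ i).le⟩ ⟨(hθ0 j).le, (hθπ j).le⟩
      (by simpa using hij)
    have hπ := pi_ne_zero
    field_simp at h
    have : (i : ℕ) + 1 = (j : ℕ) + 1 := by exact_mod_cast h
    exact Fin.ext (by omega)
  · rw [Module.End.mem_eigenspace_iff, toLin'_apply,
      toeplitzSubHankel_mulVec_sin hn _ ((j : ℕ) + 1) (by field_simp)]
    simp
  · intro h
    have h0 := congrFun h ⟨0, by omega⟩
    refine (sin_pos_of_pos_of_lt_pi ?_ ?_).ne' h0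
    · have := hθ0 j
      push_cast at this ⊢
      linarith
    · have := hθ0 j
      have := hθπ j
      push_cast at *
      linarith

/-- The determinant of the Toeplitz-minus-Hankel matrix `A(α)` equals
the product `Π_{j=1}^n ν_j(α)` of the values
`ν_j(α) = α_0 + 2·Σ_{l=1}^m α_l·cos(l·j·π·h)`, `h = 2/(2n+1)`. -/
theorem stmt4 (n m : ℕ) (hn : 2 ≤ n) (hm1 : 1 ≤ m) (hmn : m ≤ n - 1)
    (α : ℕ → ℝ) (h : ℝ) (hh : h = 2 / (2 * n + 1))
    (A : Matrix (Fin n) (Fin n) ℝ)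
    (hA : ∀ r c : Fin n, A r c =
      (if ((r : ℤ) - (c : ℤ)).natAbs ≤ m then α ((r : ℤ) - (c : ℤ)).natAbs else 0)
      - (if (r : ℕ) + (c : ℕ) + 1 ≤ m then α ((r : ℕ) + (c : ℕ) + 1) else 0)
      - (if 2 * n - (r : ℕ) - (c : ℕ) ≤ m then α (2 * n - (r : ℕ) - (c : ℕ)) else 0))
    (ν : ℕ → ℝ)
    (hν : ∀ j : ℕ, ν j = α 0 + 2 * ∑ l ∈ Finset.Icc 1 m, α l * Real.cos (l * j * π * h)) :
    A.det = ∏ j ∈ Finset.Icc 1 n, ν j := by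
  obtain rfl : A = toeplitzSubHankel n m α := by
    ext r c
    exact hA r c
  set S : Matrix (Fin n) (Fin n) ℝ := fun j c =>
    sin (((c : ℕ) + 1 / 2) * (2 * ((j : ℕ) + 1 : ℕ) * π / (2 * n + 1))) with hS
  have hdet : Sᵀ.det ≠ 0 := by
    rw [det_transpose]
    exact ((isUnit_iff_isUnit_det S).1
      (linearIndependent_rows_iff_isUnit.1 (linearIndependent_sin hn))).ne_zero
  have hmul : toeplitzSubHankel n m α * Sᵀ = Sᵀ * diagonal fun j : Fin n => ν (j + 1) := by
    ext r j
    have hj := congrFun (toeplitzSubHankel_mulVec_sin (n := n) (m := m) (by omega) α ((j : ℕ) + 1)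
      (θ := 2 * ((j : ℕ) + 1 : ℕ) * π / (2 * n + 1)) (by field_simp)) r
    rw [mul_diagonal, hν, mul_comm]
    refine hj.trans ?_
    rw [Pi.smul_apply, smul_eq_mul, transpose_apply, hS]
    congr 3
    refine Finset.sum_congr rfl fun l _ => ?_
    congr 2
    rw [hh]
    ring
  have hprod := congrArg det hmul
  rw [det_mul, det_mul, det_diagonal, mul_comm] at hprod
  rw [mul_left_cancel₀ hdet hprod, Fin.prod_univ_eq_prod_range (fun j => ν (j + 1)),
    ← Finset.Ico_add_one_right_eq_Icc, Finset.prod_Ico_eq_prod_range, Nat.add_sub_cancel]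
  simp only [add_comm]
end

section
/- The values ν_1(α), …, ν_n(α) exhaust the spectrum of A(α): for every complex number μ, if det(A(α) − μ·I) = 0 (the entries of A(α) being viewed as complex numbers), then μ = ν_j(α) for some j ∈ {1,…,n}. -/
open Real Matrix

/-- The `n × n` symmetric banded Toeplitz-plus-Hankel matrix with 0-based indices that arises from
odd reflection of the symbol `α` about `-1/2` and about `n`. -/
def reflectedBand (n m : ℕ) (α : ℕ → ℝ) : Matrix (Fin n) (Fin n) ℝ := fun r c =>
  (if ((r : ℤ) - (c : ℤ)).natAbs ≤ m then α ((r : ℤ) - (c : ℤ)).natAbs else 0)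
  - (if (r : ℕ) + (c : ℕ) + 1 ≤ m then α ((r : ℕ) + (c : ℕ) + 1) else 0)
  - (if 2 * n - (r : ℕ) - (c : ℕ) ≤ m then α (2 * n - (r : ℕ) - (c : ℕ)) else 0)

theorem Fin.sum_ite_val_eq (n k : ℕ) (f : ℕ → ℝ) :
    ∑ c : Fin n, (if (c : ℕ) = k then f c else 0) = if k < n then f k else 0 := by
  rw [Fin.sum_univ_eq_sum_range (fun c => if c = k then f c else 0) n, Finset.sum_ite_eq']
  simp

theorem reflectedBand_apply (n m : ℕ) (α : ℕ → ℝ) (r c : Fin n) :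
    reflectedBand n m α r c = ∑ l ∈ Finset.range (m + 1), α l *
      ((if ((r : ℤ) - (c : ℤ)).natAbs = l then 1 else 0)
        - (if (r : ℕ) + (c : ℕ) + 1 = l then 1 else 0)
        - (if 2 * n - (r : ℕ) - (c : ℕ) = l then 1 else 0)) := by
  simp only [mul_sub, mul_ite, mul_one, mul_zero, Finset.sum_sub_distrib, Finset.sum_ite_eq,
    Finset.mem_range, Nat.lt_succ_iff, reflectedBand]

/-- A function on `ℤ` which is odd about `-1/2` and about `n` turns the `l`-th reflected band into
the sum of the two shifts by `l`. -/
theorem sum_reflected_shift (n l r : ℕ) (hl : 1 ≤ l) (hln : l < n) (hr : r < n) (f : ℤ → ℝ)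
    (h₀ : ∀ k, f (-1 - k) = -f k) (h₁ : ∀ k, f (2 * n - k) = -f k) :
    ∑ c : Fin n, ((if ((r : ℤ) - (c : ℤ)).natAbs = l then 1 else 0)
        - (if r + (c : ℕ) + 1 = l then 1 else 0)
        - (if 2 * n - r - (c : ℕ) = l then 1 else 0)) * f c = f (r - l) + f (r + l) := by
  have left : ∑ c : Fin n, ((if (c : ℕ) + l = r then f c else 0)
      - (if r + (c : ℕ) + 1 = l then f c else 0)) = f (r - l) := by
    rw [Finset.sum_sub_distrib]
    by_cases hlr : l ≤ r
    · have e₁ : ∀ c : Fin n, ((c : ℕ) + l = r) = ((c : ℕ) = r - l) := fun c => by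
        simp only [eq_iff_iff]; omega
      have e₂ : ∀ c : Fin n, (r + (c : ℕ) + 1 = l) = False := fun c => by
        simp only [eq_iff_iff, iff_false]; omega
      simp only [e₁, e₂, if_false, Finset.sum_const_zero, sub_zero]
      rw [Fin.sum_ite_val_eq n (r - l) (fun c => f c), if_pos (by omega), Nat.cast_sub hlr]
    · have e₁ : ∀ c : Fin n, ((c : ℕ) + l = r) = False := fun c => by
        simp only [eq_iff_iff, iff_false]; omega
      have e₂ : ∀ c : Fin n, (r + (c : ℕ) + 1 = l) = ((c : ℕ) = l - r - 1) := fun c => by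
        simp only [eq_iff_iff]; omega
      simp only [e₁, e₂, if_false, Finset.sum_const_zero, zero_sub]
      rw [Fin.sum_ite_val_eq n (l - r - 1) (fun c => f c), if_pos (by omega), ← h₀]
      congr 1
      omega
  have right : ∑ c : Fin n, ((if (c : ℕ) = r + l then f c else 0)
      - (if 2 * n - r - (c : ℕ) = l then f c else 0)) = f (r + l) := by
    have e : ∀ c : Fin n, (2 * n - r - (c : ℕ) = l) = ((c : ℕ) = 2 * n - r - l) := fun c => by
      simp only [eq_iff_iff]; omega
    simp only [e]
    rw [Finset.sum_sub_distrib, Fin.sum_ite_val_eq n (r + l) (fun c => f c),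
      Fin.sum_ite_val_eq n (2 * n - r - l) (fun c => f c)]
    rcases lt_trichotomy (r + l) n with hlt | heq | hgt
    · rw [if_pos hlt, if_neg (by omega), sub_zero, Nat.cast_add]
    · rw [if_neg (by omega), if_neg (by omega), sub_zero]
      have hn := h₁ n
      rw [show (2 * n - n : ℤ) = n by ring] at hn
      rw [show (r + l : ℤ) = n by omega]
      linarith
    · rw [if_neg (by omega), if_pos (by omega), zero_sub, ← h₁]
      congr 1
      omega
  rw [← left, ← right, ← Finset.sum_add_distrib]
  refine Finset.sum_congr rfl fun c _ => ?_
  have e : (if ((r : ℤ) - (c : ℤ)).natAbs = l then (1 : ℝ) else 0) =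
      (if (c : ℕ) + l = r then 1 else 0) + (if (c : ℕ) = r + l then 1 else 0) := by
    split_ifs <;> first | omega | norm_num
  rw [e]
  simp only [sub_mul, add_mul, ite_mul, one_mul, zero_mul]
  ring

theorem reflectedBand_mulVec_sin (n m : ℕ) (hmn : m < n) (α : ℕ → ℝ) (j : ℕ) (θ : ℝ)
    (hθ : (2 * n + 1) * θ = j * (2 * π)) :
    reflectedBand n m α *ᵥ (fun c => sin ((c + 1 / 2) * θ)) =
      (α 0 + 2 * ∑ l ∈ Finset.Icc 1 m, α l * cos (l * θ)) •
        fun c : Fin n => sin ((c + 1 / 2) * θ) := by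
  set f : ℤ → ℝ := fun k => sin ((k + 1 / 2) * θ) with hf
  have h₀ : ∀ k, f (-1 - k) = -f k := fun k => by
    simp only [hf]
    rw [← sin_neg]
    congr 1
    push_cast
    ring
  have h₁ : ∀ k, f (2 * n - k) = -f k := fun k => by
    simp only [hf]
    rw [← sin_nat_mul_two_pi_sub _ j, ← hθ]
    congr 1
    push_cast
    ring
  have hfc : ∀ c : Fin n, sin (((c : ℕ) + 1 / 2) * θ) = f c := fun c => by simp [hf]
  ext r
  simp only [Matrix.mulVec, dotProduct, Pi.smul_apply, smul_eq_mul, hfc, reflectedBand_apply,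
    Finset.sum_mul]
  rw [Finset.sum_comm]
  simp only [mul_assoc, ← Finset.mul_sum]
  rw [Finset.range_eq_Ico, Finset.sum_eq_sum_Ico_succ_bot (Nat.succ_pos m), add_mul]
  congr 1
  · congr 1
    rw [Finset.sum_eq_single r]
    · rw [if_pos (by simp), if_neg (by omega), if_neg (by omega)]
      ring
    · intro c _ hc
      have : (c : ℕ) ≠ r := fun h => hc (Fin.ext h)
      rw [if_neg (by omega), if_neg (by omega), if_neg (by omega)]
      ring
    · simp
  · rw [mul_assoc, Finset.sum_mul, Finset.mul_sum]
    refine Finset.sum_congr (by ext; simp) fun l hl => ?_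
    rw [Finset.mem_Icc] at hl
    rw [sum_reflected_shift n l r (by omega) (by omega) r.2 f h₀ h₁]
    simp only [hf]
    push_cast
    rw [show ((r : ℝ) - l + 1 / 2) * θ = (r + 1 / 2) * θ - l * θ by ring,
      show ((r : ℝ) + l + 1 / 2) * θ = (r + 1 / 2) * θ + l * θ by ring, sin_sub, sin_add]
    ring

theorem linearIndependent_sin_half (n : ℕ) (hn : 2 ≤ n) :
    LinearIndependent ℝ (fun j : Fin n => fun c : Fin n =>
      sin ((c + 1 / 2) * (((j + 1 : ℕ) : ℝ) * π * (2 / (2 * n + 1))))) := by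
  have hN : (0 : ℝ) < 2 * n + 1 := by positivity
  have hπ := pi_pos
  have hj : ∀ j : Fin n, ((j + 1 : ℕ) : ℝ) ≤ n := fun j => by exact_mod_cast j.2
  have hpos : ∀ j : Fin n, 0 < ((j + 1 : ℕ) : ℝ) * π * (2 / (2 * n + 1)) := fun j => by
    positivity
  have hlt : ∀ j : Fin n, ((j + 1 : ℕ) : ℝ) * π * (2 / (2 * n + 1)) < π := fun j => by
    rw [mul_div_assoc', div_lt_iff₀ hN]
    nlinarith [hj j]
  refine Module.End.eigenvectors_linearIndependent'
    (Matrix.toLin' (reflectedBand n 1 fun l => if l = 1 then 1 else 0))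
    (fun j : Fin n => 2 * cos (((j + 1 : ℕ) : ℝ) * π * (2 / (2 * n + 1)))) ?_ _ fun j => ⟨?_, ?_⟩
  · intro i j hij
    have := injOn_cos ⟨(hpos i).le, (hlt i).le⟩ ⟨(hpos j).le, (hlt j).le⟩
      (mul_left_cancel₀ two_ne_zero hij)
    have hc : (0 : ℝ) < 2 / (2 * n + 1) := by positivity
    have := mul_right_cancel₀ hπ.ne' (mul_right_cancel₀ hc.ne' this)
    exact Fin.ext (Nat.succ_injective (Nat.cast_injective this))
  · rw [Module.End.mem_eigenspace_iff, Matrix.toLin'_apply,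
      reflectedBand_mulVec_sin n 1 (by omega) _ (j + 1) _ (by field_simp)]
    simp
  · intro h
    have h := congrFun h ⟨0, by omega⟩
    have hs := sin_pos_of_pos_of_lt_pi (half_pos (hpos j)) (by linarith [hlt j])
    refine hs.ne' (Eq.trans ?_ h)
    congr 1
    push_cast
    ring

/-- The values `ν_1(α), …, ν_n(α)` exhaust the spectrum of `A(α)`:
for every complex `μ`, if `det(A(α) − μ·I) = 0` (entries of `A(α)` viewed as complex
numbers), then `μ = ν_j(α)` for some `j ∈ {1,…,n}`. -/
theorem stmt5 (n m : ℕ) (hn : 2 ≤ n) (hm1 : 1 ≤ m) (hmn : m ≤ n - 1)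
    (α : ℕ → ℝ) (h : ℝ) (hh : h = 2 / (2 * n + 1))
    (A : Matrix (Fin n) (Fin n) ℝ)
    (hA : ∀ r c : Fin n, A r c =
      (if ((r : ℤ) - (c : ℤ)).natAbs ≤ m then α ((r : ℤ) - (c : ℤ)).natAbs else 0)
      - (if (r : ℕ) + (c : ℕ) + 1 ≤ m then α ((r : ℕ) + (c : ℕ) + 1) else 0)
      - (if 2 * n - (r : ℕ) - (c : ℕ) ≤ m then α (2 * n - (r : ℕ) - (c : ℕ)) else 0))
    (ν : ℕ → ℝ)
    (hν : ∀ j : ℕ, ν j = α 0 + 2 * ∑ l ∈ Finset.Icc 1 m, α l * Real.cos (l * j * π * h)) :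
    ∀ μ : ℂ, (A.map (Complex.ofReal) - μ • (1 : Matrix (Fin n) (Fin n) ℂ)).det = 0 →
      ∃ j : ℕ, 1 ≤ j ∧ j ≤ n ∧ μ = (ν j : ℂ) := by
  intro μ hμ
  subst hh
  have hAB : A = reflectedBand n m α := by
    ext r c
    exact hA r c
  let P : Matrix (Fin n) (Fin n) ℝ := fun c j =>
    sin ((c + 1 / 2) * (((j + 1 : ℕ) : ℝ) * π * (2 / (2 * n + 1))))
  have hP : P.det ≠ 0 := by
    have hunit : IsUnit P := Matrix.linearIndependent_cols_iff_isUnit.1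
      (linearIndependent_sin_half n hn)
    exact ((Matrix.isUnit_iff_isUnit_det P).1 hunit).ne_zero
  have hAP : A * P = P * Matrix.diagonal fun j : Fin n => ν (j + 1) := by
    ext r j
    have hev := congrFun (reflectedBand_mulVec_sin n m (by omega) α (j + 1)
      (((j + 1 : ℕ) : ℝ) * π * (2 / (2 * n + 1))) (by field_simp)) r
    have hνj : ν (j + 1) = α 0 + 2 * ∑ l ∈ Finset.Icc 1 m,
        α l * cos (l * (((j + 1 : ℕ) : ℝ) * π * (2 / (2 * n + 1)))) := by
      simp only [hν, mul_assoc]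
    rw [Matrix.mul_diagonal, hνj, mul_comm (P r j), hAB]
    exact hev
  have hAP' : A.map Complex.ofReal * P.map Complex.ofReal =
      P.map Complex.ofReal * Matrix.diagonal fun j : Fin n => (ν (j + 1) : ℂ) := by
    have := congrArg (fun M : Matrix (Fin n) (Fin n) ℝ => M.map Complex.ofRealHom) hAP
    simp only [Matrix.map_mul, Matrix.diagonal_map (map_zero Complex.ofRealHom)] at this
    exact this
  have hP' : (P.map Complex.ofReal).det ≠ 0 := by
    have := Complex.ofRealHom.map_det P
    intro h0
    exact hP (Complex.ofReal_eq_zero.1 (this.trans h0))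
  have hdet : (Matrix.diagonal fun j : Fin n => (ν (j + 1) : ℂ) - μ).det = 0 := by
    refine (mul_eq_zero.1 ?_).resolve_left hP'
    rw [← Matrix.det_mul, ← Matrix.diagonal_sub, mul_sub, ← hAP',
      ← Matrix.smul_one_eq_diagonal, mul_smul_comm, mul_one,
      show μ • P.map Complex.ofReal = (μ • (1 : Matrix (Fin n) (Fin n) ℂ)) * P.map Complex.ofReal by
        rw [smul_mul_assoc, one_mul], ← sub_mul, Matrix.det_mul, hμ, zero_mul]
  rw [Matrix.det_diagonal, Finset.prod_eq_zero_iff] at hdet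
  obtain ⟨j, -, hj⟩ := hdet
  exact ⟨j + 1, by omega, j.2, (sub_eq_zero.1 hj).symm⟩
end

section
/- For every j ∈ {1,…,n}, the vector y_j with entries y_{j,k} = sin(j·π·(n−k+1/2)·h) satisfies A'(α)·y_j = ν_j(α)·y_j, where ν_j(α) = α_0 + 2·Σ_{l=1}^{m} α_l·cos(l·j·π·h); that is, the anti-diagonally flipped Toeplitz-minus-Hankel matrix A'(α) has the same eigenvalues ν_j(α) with the index-reversed eigenvectors. -/
open Real Matrix

/-- Summing against the indicator of an integer position picks out one value. -/
theorem sum_fin_ite_eq_int (n : ℕ) (Y : ℤ → ℝ) (z : ℤ) :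
    ∑ c : Fin n, (if (c : ℤ) + 1 = z then Y ((c : ℤ) + 1) else 0)
      = if 1 ≤ z ∧ z ≤ n then Y z else 0 := by
  split_ifs with hz
  · have hlt : (z - 1).toNat < n := by omega
    rw [Finset.sum_eq_single (⟨(z - 1).toNat, hlt⟩ : Fin n)]
    · have hc : (((z - 1).toNat : ℕ) : ℤ) + 1 = z := by omega
      simp only [hc, if_true]
    · intro c _ hc
      refine if_neg fun hcz => hc (Fin.ext ?_)
      simp only
      omega
    · simp
  · refine Finset.sum_eq_zero fun c _ => if_neg ?_
    have := c.isLt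
    omega

/-- A single diagonal at distance `l ≥ 1`, with its two reflections, acts on a sequence which is
odd about `0` and about `n + 1/2` as the shift sum. -/
theorem sum_reflected_diagonal (n l : ℕ) (hl : 1 ≤ l) (hln : l < n) (Y : ℤ → ℝ)
    (hodd : ∀ k, Y (-k) = -Y k) (hrefl : ∀ k, Y (2 * n + 1 - k) = -Y k) (r : Fin n) :
    ∑ c : Fin n, ((if ((r : ℤ) - (c : ℤ)).natAbs = l then 1 else 0)
        - (if (r : ℕ) + (c : ℕ) + 2 = l then 1 else 0)
        - (if 2 * n - 1 - (r : ℕ) - (c : ℕ) = l then 1 else 0)) * Y ((c : ℤ) + 1)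
      = Y ((r : ℤ) + 1 + l) + Y ((r : ℤ) + 1 - l) := by
  have hr := r.isLt
  have key : ∀ c : Fin n, ((if ((r : ℤ) - (c : ℤ)).natAbs = l then (1 : ℝ) else 0)
        - (if (r : ℕ) + (c : ℕ) + 2 = l then 1 else 0)
        - (if 2 * n - 1 - (r : ℕ) - (c : ℕ) = l then 1 else 0)) * Y ((c : ℤ) + 1)
      = (if (c : ℤ) + 1 = (r : ℤ) + 1 + l then Y ((c : ℤ) + 1) else 0)
        + (if (c : ℤ) + 1 = (r : ℤ) + 1 - l then Y ((c : ℤ) + 1) else 0)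
        - (if (c : ℤ) + 1 = -((r : ℤ) + 1 - l) then Y ((c : ℤ) + 1) else 0)
        - (if (c : ℤ) + 1 = 2 * n + 1 - ((r : ℤ) + 1 + l) then Y ((c : ℤ) + 1) else 0) := by
    intro c
    have hc := c.isLt
    have h1 : (if ((r : ℤ) - (c : ℤ)).natAbs = l then (1 : ℝ) else 0)
        = (if (c : ℤ) + 1 = (r : ℤ) + 1 + l then 1 else 0)
          + (if (c : ℤ) + 1 = (r : ℤ) + 1 - l then 1 else 0) := by
      split_ifs <;> first | omega | norm_num
    have h2 : ((r : ℕ) + (c : ℕ) + 2 = l) ↔ (c : ℤ) + 1 = -((r : ℤ) + 1 - l) := by omega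
    have h3 : (2 * n - 1 - (r : ℕ) - (c : ℕ) = l) ↔
        (c : ℤ) + 1 = 2 * n + 1 - ((r : ℤ) + 1 + l) := by omega
    simp only [h1, h2, h3, sub_mul, add_mul, ite_mul, one_mul, zero_mul]
  simp only [key, Finset.sum_sub_distrib, Finset.sum_add_distrib, sum_fin_ite_eq_int, hodd, hrefl]
  have h0 : Y 0 = 0 := by have := hodd 0; simp only [neg_zero] at this; linarith
  have hright : (if 1 ≤ (r : ℤ) + 1 + l ∧ (r : ℤ) + 1 + l ≤ n then Y ((r : ℤ) + 1 + l) else 0)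
      - (if 1 ≤ 2 * (n : ℤ) + 1 - ((r : ℤ) + 1 + l) ∧ 2 * (n : ℤ) + 1 - ((r : ℤ) + 1 + l) ≤ n
          then -Y ((r : ℤ) + 1 + l) else 0) = Y ((r : ℤ) + 1 + l) := by
    split_ifs <;> first | omega | ring
  have hleft : (if 1 ≤ (r : ℤ) + 1 - l ∧ (r : ℤ) + 1 - l ≤ n then Y ((r : ℤ) + 1 - l) else 0)
      - (if 1 ≤ -((r : ℤ) + 1 - l) ∧ -((r : ℤ) + 1 - l) ≤ n
          then -Y ((r : ℤ) + 1 - l) else 0) = Y ((r : ℤ) + 1 - l) := by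
    rcases eq_or_ne ((r : ℤ) + 1 - l) 0 with hz | hz
    · simp [hz, h0]
    · split_ifs <;> first | omega | ring
  linarith

/-- The main diagonal acts as the identity; the reflected terms do not reach distance `0`. -/
theorem sum_main_diagonal (n : ℕ) (Y : ℤ → ℝ) (r : Fin n) :
    ∑ c : Fin n, ((if ((r : ℤ) - (c : ℤ)).natAbs = 0 then 1 else 0)
        - (if (r : ℕ) + (c : ℕ) + 2 = 0 then 1 else 0)
        - (if 2 * n - 1 - (r : ℕ) - (c : ℕ) = 0 then 1 else 0)) * Y ((c : ℤ) + 1)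
      = Y ((r : ℤ) + 1) := by
  have hr := r.isLt
  rw [Finset.sum_eq_single r]
  · have h3 : ¬ (2 * n - 1 - (r : ℕ) - (r : ℕ) = 0) := by omega
    simp [h3]
  · intro c _ hc
    have hlt := c.isLt
    have hne : (c : ℕ) ≠ r := fun e => hc (Fin.ext e)
    have h1 : ¬ (((r : ℤ) - (c : ℤ)).natAbs = 0) := by omega
    have h3 : ¬ (2 * n - 1 - (r : ℕ) - (c : ℕ) = 0) := by omega
    rw [if_neg h1, if_neg (by omega), if_neg h3]
    ring
  · simp

/-- A truncated coefficient as a combination of indicators. -/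
theorem ite_le_eq_sum_indicator (m a : ℕ) (α : ℕ → ℝ) :
    (if a ≤ m then α a else 0)
      = ∑ l ∈ Finset.range (m + 1), α l * (if a = l then 1 else 0) := by
  simp [Finset.sum_ite_eq]

/-- For every `j ∈ {1,…,n}`, the vector `y_j` with entries
`y_{j,k} = sin(j·π·(n−k+1/2)·h)` satisfies `A'(α)·y_j = ν_j(α)·y_j`, where
`A'(α)` is `T^{(α,m)}` minus the anti-diagonal transpose of the Hankel matrix
`H^{(α,m)}`, with 1-based entries
`A'(α)_{r,c} = α_{|r−c|}·[|r−c| ≤ m] − α_{r+c}·[r+c ≤ m] − α_{2n+1−r−c}·[2n+1−r−c ≤ m]`,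
and `h = 2/(2n+1)`. -/
theorem stmt6 (n m : ℕ) (hn : 2 ≤ n) (hm1 : 1 ≤ m) (hmn : m ≤ n - 1)
    (α : ℕ → ℝ) (h : ℝ) (hh : h = 2 / (2 * n + 1))
    (A' : Matrix (Fin n) (Fin n) ℝ)
    (hA' : ∀ r c : Fin n, A' r c =
      (if ((r : ℤ) - (c : ℤ)).natAbs ≤ m then α ((r : ℤ) - (c : ℤ)).natAbs else 0)
      - (if (r : ℕ) + (c : ℕ) + 2 ≤ m then α ((r : ℕ) + (c : ℕ) + 2) else 0)
      - (if 2 * n - 1 - (r : ℕ) - (c : ℕ) ≤ m then α (2 * n - 1 - (r : ℕ) - (c : ℕ)) else 0))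
    (y : ℕ → Fin n → ℝ)
    (hy : ∀ (j : ℕ) (k : Fin n), y j k = Real.sin (j * π * ((n : ℝ) - (k : ℝ) - 1 / 2) * h))
    (ν : ℕ → ℝ)
    (hν : ∀ j : ℕ, ν j = α 0 + 2 * ∑ l ∈ Finset.Icc 1 m, α l * Real.cos (l * j * π * h)) :
    ∀ j : ℕ, 1 ≤ j → j ≤ n → A'.mulVec (y j) = ν j • y j := by
  intro j _ _
  set Y : ℤ → ℝ := fun k => Real.sin (j * π * ((n : ℝ) + 1 / 2 - k) * h) with hY
  have hN : (2 * (n : ℝ) + 1) ≠ 0 := by positivity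
  have hyY : ∀ k : Fin n, y j k = Y ((k : ℤ) + 1) := by
    intro k
    rw [hy, hY]
    push_cast
    ring_nf
  have hodd : ∀ k, Y (-k) = -Y k := by
    intro k
    have e1 : (j : ℝ) * π * ((n : ℝ) + 1 / 2 - ((-k : ℤ) : ℝ)) * h = j * π + j * π * k * h := by
      rw [hh]; push_cast; field_simp; ring
    have e2 : (j : ℝ) * π * ((n : ℝ) + 1 / 2 - (k : ℝ)) * h = j * π - j * π * k * h := by
      rw [hh]; field_simp
    simp only [hY, e1, e2, Real.sin_add, Real.sin_sub, Real.sin_nat_mul_pi]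
    ring
  have hrefl : ∀ k, Y (2 * n + 1 - k) = -Y k := by
    intro k
    simp only [hY, ← Real.sin_neg]
    push_cast
    ring_nf
  have hshift : ∀ (k : ℤ) (l : ℕ), Y (k + l) + Y (k - l) = 2 * Real.cos (l * j * π * h) * Y k := by
    intro k l
    have e1 : (j : ℝ) * π * ((n : ℝ) + 1 / 2 - ((k + l : ℤ) : ℝ)) * h
        = j * π * ((n : ℝ) + 1 / 2 - k) * h - l * j * π * h := by push_cast; ring
    have e2 : (j : ℝ) * π * ((n : ℝ) + 1 / 2 - ((k - l : ℤ) : ℝ)) * h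
        = j * π * ((n : ℝ) + 1 / 2 - k) * h + l * j * π * h := by push_cast; ring
    simp only [hY, e1, e2, Real.sin_add, Real.sin_sub]
    ring
  ext r
  simp only [Matrix.mulVec, dotProduct, Pi.smul_apply, smul_eq_mul, hyY, hA',
    ite_le_eq_sum_indicator, ← Finset.sum_sub_distrib, ← mul_sub, Finset.sum_mul, mul_assoc]
  rw [Finset.sum_comm]
  simp only [← Finset.mul_sum]
  rw [Finset.range_eq_Ico, Finset.sum_eq_sum_Ico_succ_bot (Nat.succ_pos m), sum_main_diagonal, hν,
    add_mul, mul_assoc 2, Finset.sum_mul, Finset.mul_sum]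
  congr 1
  refine Finset.sum_congr (by ext; simp) fun l hl => ?_
  rw [Finset.mem_Icc] at hl
  rw [sum_reflected_diagonal n l hl.1 (by omega) Y hodd hrefl r, hshift]
  ring
end

section
/- For every j ∈ {1,…,n}, the vector z_j with entries z_{j,k} = sin((j−1/2)·π·(k−1/2)·h), where h = 1/n, satisfies C(α)·z_j = μ_j(α)·z_j with μ_j(α) = α_0 + 2·Σ_{l=1}^{m} α_l·cos(l·(j−1/2)·π·h); that is, z_j is an eigenvector of the matrix C(α), which arises from discretisations of the Laplacian with mixed Dirichlet–Neumann boundary conditions, with eigenvalue μ_j(α). -/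
open Real Matrix

theorem sum_int_Icc_sub_add (F : ℤ → ℝ) (r : ℤ) (m : ℕ) :
    ∑ x ∈ Finset.Icc (r - m) (r + m), F x =
      F r + ∑ l ∈ Finset.Icc 1 m, (F (r + l) + F (r - l)) := by
  induction m with
  | zero => simp
  | succ k ih =>
    have hset : Finset.Icc (r - (k + 1 : ℕ)) (r + (k + 1 : ℕ)) =
        insert (r - (k + 1 : ℕ)) (insert (r + (k + 1 : ℕ)) (Finset.Icc (r - k) (r + k))) := by
      ext x
      simp only [Finset.mem_insert, Finset.mem_Icc]
      omega
    rw [hset, Finset.sum_insert, Finset.sum_insert, ih, Finset.sum_Icc_succ_top (by omega)]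
    · ring
    · simp only [Finset.mem_Icc]
      omega
    · simp only [Finset.mem_insert, Finset.mem_Icc]
      omega

theorem sum_int_Ico_eq_sum_range (F : ℤ → ℝ) (a : ℤ) (k : ℕ) :
    ∑ x ∈ Finset.Ico a (a + k), F x = ∑ i ∈ Finset.range k, F (a + i) := by
  induction k with
  | zero => simp
  | succ k ih =>
    have hset : Finset.Ico a (a + (k + 1 : ℕ)) = insert (a + k) (Finset.Ico a (a + k)) := by
      ext x
      simp only [Finset.mem_insert, Finset.mem_Ico]
      omega
    rw [hset, Finset.sum_insert (by simp), ih, Finset.sum_range_succ, add_comm]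

theorem sum_int_Ico_eq_sum_reflections (F : ℤ → ℝ) (n : ℕ) :
    ∑ x ∈ Finset.Ico (-n : ℤ) (2 * n), F x =
      ∑ c ∈ Finset.range n, (F c + F (-1 - c) + F (2 * n - 1 - c)) := by
  have hn : (2 * n : ℤ) = -n + (n + n + n : ℕ) := by push_cast; ring
  rw [hn, sum_int_Ico_eq_sum_range, Finset.sum_range_add, Finset.sum_range_add, ← hn,
    Finset.sum_add_distrib, Finset.sum_add_distrib,
    ← Finset.sum_range_reflect (fun i : ℕ => F (-n + i)),
    ← Finset.sum_range_reflect (fun i : ℕ => F (-n + (n + n + i : ℕ))),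
    add_comm (∑ c ∈ Finset.range n, F c)]
  congr 1
  · congr 1
    · refine Finset.sum_congr rfl fun i hi => congrArg F ?_
      have := Finset.mem_range.1 hi
      omega
    · refine Finset.sum_congr rfl fun i hi => congrArg F ?_
      push_cast
      ring
  · refine Finset.sum_congr rfl fun i hi => congrArg F ?_
    have := Finset.mem_range.1 hi
    omega

/-- For every `j ∈ {1,…,n}`, the vector `z_j` with entries
`z_{j,k} = sin((j−1/2)·π·(k−1/2)·h)`, `h = 1/n`, is an eigenvector of the matrix
`C(α)` with 1-based entries
`C(α)_{r,c} = α_{|r−c|}·[|r−c| ≤ m] − α_{r+c−1}·[r+c−1 ≤ m] + α_{2n+1−r−c}·[2n+1−r−c ≤ m]`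
(a mixed Dirichlet–Neumann pattern) with eigenvalue
`μ_j(α) = α_0 + 2·Σ_{l=1}^m α_l·cos(l·(j−1/2)·π·h)`. -/
theorem stmt7 (n m : ℕ) (hn : 2 ≤ n) (hm1 : 1 ≤ m) (hmn : m ≤ n - 1)
    (α : ℕ → ℝ) (h : ℝ) (hh : h = 1 / n)
    (C : Matrix (Fin n) (Fin n) ℝ)
    (hC : ∀ r c : Fin n, C r c =
      (if ((r : ℤ) - (c : ℤ)).natAbs ≤ m then α ((r : ℤ) - (c : ℤ)).natAbs else 0)
      - (if (r : ℕ) + (c : ℕ) + 1 ≤ m then α ((r : ℕ) + (c : ℕ) + 1) else 0)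
      + (if 2 * n - 1 - (r : ℕ) - (c : ℕ) ≤ m then α (2 * n - 1 - (r : ℕ) - (c : ℕ)) else 0))
    (z : ℕ → Fin n → ℝ)
    (hz : ∀ (j : ℕ) (k : Fin n),
      z j k = Real.sin (((j : ℝ) - 1 / 2) * π * ((k : ℝ) + 1 / 2) * h))
    (μ : ℕ → ℝ)
    (hμ : ∀ j : ℕ,
      μ j = α 0 + 2 * ∑ l ∈ Finset.Icc 1 m, α l * Real.cos (l * ((j : ℝ) - 1 / 2) * π * h)) :
    ∀ j : ℕ, 1 ≤ j → j ≤ n → C.mulVec (z j) = μ j • z j := by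
  intro j _ _
  have hn0 : (n : ℝ) ≠ 0 := by
    have : n ≠ 0 := by omega
    exact_mod_cast this
  have hnh : (n : ℝ) * h = 1 := by rw [hh]; field_simp
  let f : ℤ → ℝ := fun x => Real.sin (((j : ℝ) - 1 / 2) * π * ((x : ℝ) + 1 / 2) * h)
  let a : ℕ → ℝ := fun d => if d ≤ m then α d else 0
  have f_left (x : ℤ) : f (-1 - x) = -f x := by
    simp only [f, ← Real.sin_neg]
    congr 1
    push_cast
    ring
  have f_right (x : ℤ) : f (2 * n - 1 - x) = f x := by
    have harg : ((j : ℝ) - 1 / 2) * π * (((2 * n - 1 - x : ℤ) : ℝ) + 1 / 2) * h =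
        (π - ((j : ℝ) - 1 / 2) * π * ((x : ℝ) + 1 / 2) * h) + ((j - 1 : ℤ) : ℝ) * (2 * π) := by
      push_cast
      linear_combination ((2 * (j : ℝ) - 1) * π) * hnh
    simp only [f]
    rw [harg, Real.sin_add_int_mul_two_pi, Real.sin_pi_sub]
  have f_shift (x : ℤ) (l : ℕ) :
      f (x + l) + f (x - l) = 2 * Real.cos (l * ((j : ℝ) - 1 / 2) * π * h) * f x := by
    have hadd : ((j : ℝ) - 1 / 2) * π * (((x + l : ℤ) : ℝ) + 1 / 2) * h =
        ((j : ℝ) - 1 / 2) * π * ((x : ℝ) + 1 / 2) * h + l * ((j : ℝ) - 1 / 2) * π * h := by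
      push_cast
      ring
    have hsub : ((j : ℝ) - 1 / 2) * π * (((x - l : ℤ) : ℝ) + 1 / 2) * h =
        ((j : ℝ) - 1 / 2) * π * ((x : ℝ) + 1 / 2) * h - l * ((j : ℝ) - 1 / 2) * π * h := by
      push_cast
      ring
    simp only [f]
    rw [hadd, hsub, Real.sin_add, Real.sin_sub]
    ring
  ext r
  have hr := r.isLt
  let G : ℤ → ℝ := fun x => a ((r : ℤ) - x).natAbs * f x
  have hrow : C.mulVec (z j) r = ∑ x ∈ Finset.Ico (-n : ℤ) (2 * n), G x := by
    rw [Matrix.mulVec, dotProduct, sum_int_Ico_eq_sum_reflections,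
      Finset.sum_range fun c : ℕ => G c + G (-1 - c) + G (2 * n - 1 - c)]
    refine Finset.sum_congr rfl fun c _ => ?_
    have hc := c.isLt
    have hzc : z j c = f (c : ℕ) := by simp [hz, f]
    have hleft : ((r : ℤ) - (-1 - (c : ℕ))).natAbs = r + c + 1 := by omega
    have hright : ((r : ℤ) - (2 * n - 1 - (c : ℕ))).natAbs = 2 * n - 1 - r - c := by omega
    simp only [G, hC, hzc, f_left, f_right, hleft, hright, a]
    ring
  have hband : ∑ x ∈ Finset.Icc ((r : ℤ) - m) (r + m), G x =
      ∑ x ∈ Finset.Ico (-n : ℤ) (2 * n), G x := by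
    refine Finset.sum_subset (fun x hx => ?_) fun x _ hx => ?_
    · rw [Finset.mem_Icc] at hx
      rw [Finset.mem_Ico]
      omega
    · rw [Finset.mem_Icc] at hx
      have hfar : ¬ ((r : ℤ) - x).natAbs ≤ m := by omega
      simp [G, a, hfar]
  have hzr : z j r = f (r : ℕ) := by simp [hz, f]
  rw [hrow, ← hband, sum_int_Icc_sub_add, Pi.smul_apply, smul_eq_mul, hμ, hzr, add_mul,
    Finset.mul_sum, Finset.sum_mul]
  congr 1
  · simp [G, a]
  · refine Finset.sum_congr rfl fun l hl => ?_
    have hlm := (Finset.mem_Icc.1 hl).2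
    have hplus : ((r : ℤ) - (r + l)).natAbs = l := by omega
    have hminus : ((r : ℤ) - (r - l)).natAbs = l := by omega
    simp only [G, a, hplus, hminus, if_pos hlm, ← mul_add, f_shift]
    ring
end

section
/- Suppose additionally that real numbers β_0, …, β_m are given and that the matrix C(β), built from β by the same construction as C(α), is invertible. Then for every j ∈ {1,…,n} one has μ_j(β) ≠ 0 and C(α)·z_j = (μ_j(α)/μ_j(β))·(C(β)·z_j); that is, (μ_j(α)/μ_j(β), z_j) is an eigenpair of the generalized eigenvalue problem C(α) x = λ C(β) x. -/
open Real Matrix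

lemma sum_fin_ite_intCast_eq (n : ℕ) (f : ℤ → ℝ) (a : ℤ) :
    ∑ c : Fin n, (if ((c : ℕ) : ℤ) = a then f (c : ℕ) else 0)
      = if 0 ≤ a ∧ a < n then f a else 0 := by
  split_ifs with ha
  · obtain ⟨h0, h1⟩ := ha
    lift a to ℕ using h0
    have h2 : a < n := by exact_mod_cast h1
    rw [Finset.sum_eq_single (⟨a, h2⟩ : Fin n)]
    · simp
    · intro b _ hb
      rw [if_neg]
      intro hba
      exact hb (Fin.ext (by exact_mod_cast hba))
    · simp
  · refine Finset.sum_eq_zero fun c _ => if_neg fun hc => ha ?_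
    have := c.isLt
    omega

/-- Folding a sequence that is odd about `-1/2` and even about `n - 1/2` back to `{0, …, n - 1}`. -/
lemma sum_fin_folded_shift (n : ℕ) (s : ℤ → ℝ) (hodd : ∀ k, s (-1 - k) = -s k)
    (heven : ∀ k, s (2 * n - 1 - k) = s k) (r : Fin n) (l : ℕ) (hl : 1 ≤ l) (hln : l < n) :
    ∑ c : Fin n, ((if ((r : ℤ) - (c : ℤ)).natAbs = l then 1 else 0)
      - (if (r : ℕ) + (c : ℕ) + 1 = l then 1 else 0)
      + (if 2 * n - 1 - (r : ℕ) - (c : ℕ) = l then 1 else 0)) * s (c : ℕ)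
      = s ((r : ℕ) - l) + s ((r : ℕ) + l) := by
  have hr := r.isLt
  have key : ∀ c : Fin n, ((if ((r : ℤ) - (c : ℤ)).natAbs = l then (1 : ℝ) else 0)
      - (if (r : ℕ) + (c : ℕ) + 1 = l then 1 else 0)
      + (if 2 * n - 1 - (r : ℕ) - (c : ℕ) = l then 1 else 0)) * s (c : ℕ)
      = (if ((c : ℕ) : ℤ) = (r : ℕ) - l then s (c : ℕ) else 0)
        + (if ((c : ℕ) : ℤ) = (r : ℕ) + l then s (c : ℕ) else 0)
        - (if ((c : ℕ) : ℤ) = -1 - ((r : ℕ) - l) then s (c : ℕ) else 0)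
        + (if ((c : ℕ) : ℤ) = 2 * n - 1 - ((r : ℕ) + l) then s (c : ℕ) else 0) := by
    intro c
    have hc := c.isLt
    have e1 : (if ((r : ℤ) - (c : ℤ)).natAbs = l then (1 : ℝ) else 0)
        = (if ((c : ℕ) : ℤ) = (r : ℕ) - l then 1 else 0)
          + (if ((c : ℕ) : ℤ) = (r : ℕ) + l then 1 else 0) := by
      split_ifs <;> first | omega | norm_num
    have e2 : (r : ℕ) + (c : ℕ) + 1 = l ↔ ((c : ℕ) : ℤ) = -1 - ((r : ℕ) - l) := by omega
    have e3 : 2 * n - 1 - (r : ℕ) - (c : ℕ) = l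
        ↔ ((c : ℕ) : ℤ) = 2 * n - 1 - ((r : ℕ) + l) := by omega
    rw [e1]
    simp only [e2, e3, add_mul, sub_mul, ite_mul, one_mul, zero_mul]
  simp only [key, Finset.sum_add_distrib, Finset.sum_sub_distrib, sum_fin_ite_intCast_eq, hodd,
    heven]
  split_ifs <;> first | omega | ring

lemma sum_fin_folded_zero (n : ℕ) (s : ℤ → ℝ) (r : Fin n) :
    ∑ c : Fin n, ((if ((r : ℤ) - (c : ℤ)).natAbs = 0 then 1 else 0)
      - (if (r : ℕ) + (c : ℕ) + 1 = 0 then 1 else 0)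
      + (if 2 * n - 1 - (r : ℕ) - (c : ℕ) = 0 then 1 else 0)) * s (c : ℕ) = s (r : ℕ) := by
  rw [Finset.sum_eq_single r]
  · have hr := r.isLt
    rw [if_pos (by omega), if_neg (by omega), if_neg (by omega)]
    ring
  · intro c _ hc
    have hr := r.isLt
    have hcn := c.isLt
    have : (c : ℕ) ≠ r := fun e => hc (Fin.ext e)
    rw [if_neg (by omega), if_neg (by omega), if_neg (by omega)]
    ring
  · simp

lemma ite_le_eq_sum_range (m a : ℕ) (ξ : ℕ → ℝ) :
    (if a ≤ m then ξ a else 0) = ∑ l ∈ Finset.range (m + 1), ξ l * (if a = l then 1 else 0) := by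
  simp

/-- The symbol of a folded banded Toeplitz matrix, acting on the samples `sin ((k + 1/2) θ)`. -/
lemma sum_fin_folded_sin (n m : ℕ) (hmn : m < n) (ξ : ℕ → ℝ) (θ : ℝ)
    (hθ : ∀ x, sin (2 * n * θ - x) = sin x) (r : Fin n) :
    ∑ c : Fin n,
      ((if ((r : ℤ) - (c : ℤ)).natAbs ≤ m then ξ ((r : ℤ) - (c : ℤ)).natAbs else 0)
      - (if (r : ℕ) + (c : ℕ) + 1 ≤ m then ξ ((r : ℕ) + (c : ℕ) + 1) else 0)
      + (if 2 * n - 1 - (r : ℕ) - (c : ℕ) ≤ m then ξ (2 * n - 1 - (r : ℕ) - (c : ℕ)) else 0))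
        * sin (((c : ℕ) + 1 / 2) * θ)
      = (ξ 0 + 2 * ∑ l ∈ Finset.Icc 1 m, ξ l * cos (l * θ)) * sin (((r : ℕ) + 1 / 2) * θ) := by
  set s : ℤ → ℝ := fun k => sin ((k + 1 / 2) * θ) with hs
  have hodd : ∀ k, s (-1 - k) = -s k := by
    intro k
    simp only [hs]
    rw [← sin_neg]
    push_cast
    ring_nf
  have heven : ∀ k, s (2 * n - 1 - k) = s k := by
    intro k
    simp only [hs]
    rw [← hθ ((k + 1 / 2) * θ)]
    push_cast
    ring_nf
  have hsn : ∀ k : ℕ, sin (((k : ℝ) + 1 / 2) * θ) = s (k : ℕ) := fun k => by simp [hs]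
  simp only [hsn, ite_le_eq_sum_range, ← Finset.sum_sub_distrib, ← Finset.sum_add_distrib,
    ← mul_sub, ← mul_add, Finset.sum_mul]
  rw [Finset.sum_comm]
  simp only [mul_assoc, ← Finset.mul_sum]
  rw [Finset.range_eq_Ico, Finset.sum_eq_sum_Ico_succ_bot (Nat.succ_pos m),
    sum_fin_folded_zero, add_mul, mul_assoc, Finset.sum_mul, Finset.mul_sum]
  congr 1
  refine Finset.sum_congr (by ext; simp) fun l hl => ?_
  rw [Finset.mem_Icc] at hl
  rw [sum_fin_folded_shift n s hodd heven r l hl.1 (by omega)]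
  have h1 : s ((r : ℕ) - l) = sin (((r : ℕ) + 1 / 2) * θ - l * θ) := by
    simp only [hs]; push_cast; ring_nf
  have h2 : s ((r : ℕ) + l) = sin (((r : ℕ) + 1 / 2) * θ + l * θ) := by
    simp only [hs]; push_cast; ring_nf
  rw [h1, h2, ← hsn, sin_sub, sin_add]
  ring

/-- With `C(α)` and `C(β)` built by the same mixed Dirichlet–Neumann
construction, if `C(β)` is invertible then for every `j ∈ {1,…,n}` one has
`μ_j(β) ≠ 0` and `(μ_j(α)/μ_j(β), z_j)` is an eigenpair of the generalized
eigenvalue problem `C(α) x = λ C(β) x`. -/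
theorem stmt8 (n m : ℕ) (hn : 2 ≤ n) (hm1 : 1 ≤ m) (hmn : m ≤ n - 1)
    (α β : ℕ → ℝ) (h : ℝ) (hh : h = 1 / n)
    (C : (ℕ → ℝ) → Matrix (Fin n) (Fin n) ℝ)
    (hC : ∀ (ξ : ℕ → ℝ) (r c : Fin n), C ξ r c =
      (if ((r : ℤ) - (c : ℤ)).natAbs ≤ m then ξ ((r : ℤ) - (c : ℤ)).natAbs else 0)
      - (if (r : ℕ) + (c : ℕ) + 1 ≤ m then ξ ((r : ℕ) + (c : ℕ) + 1) else 0)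
      + (if 2 * n - 1 - (r : ℕ) - (c : ℕ) ≤ m then ξ (2 * n - 1 - (r : ℕ) - (c : ℕ)) else 0))
    (z : ℕ → Fin n → ℝ)
    (hz : ∀ (j : ℕ) (k : Fin n),
      z j k = Real.sin (((j : ℝ) - 1 / 2) * π * ((k : ℝ) + 1 / 2) * h))
    (μ : (ℕ → ℝ) → ℕ → ℝ)
    (hμ : ∀ (ξ : ℕ → ℝ) (j : ℕ),
      μ ξ j = ξ 0 + 2 * ∑ l ∈ Finset.Icc 1 m, ξ l * Real.cos (l * ((j : ℝ) - 1 / 2) * π * h))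
    (hB : Invertible (C β)) :
    ∀ j : ℕ, 1 ≤ j → j ≤ n →
      μ β j ≠ 0 ∧ (C α).mulVec (z j) = (μ α j / μ β j) • (C β).mulVec (z j) := by
  intro j hj1 hjn
  have hn0 : (0 : ℝ) < n := by exact_mod_cast (by omega : 0 < n)
  have hj1' : (1 : ℝ) ≤ j := by exact_mod_cast hj1
  have hjn' : (j : ℝ) ≤ n := by exact_mod_cast hjn
  have hreflect : ∀ x, sin (2 * n * (((j : ℝ) - 1 / 2) * π * h) - x) = sin x := by
    intro x
    have : 2 * n * (((j : ℝ) - 1 / 2) * π * h) - x = (π - x) + ((j - 1 : ℤ) : ℝ) * (2 * π) := by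
      rw [hh]
      push_cast
      field_simp
      ring
    rw [this, sin_add_int_mul_two_pi, sin_pi_sub]
  have eig : ∀ ξ, (C ξ).mulVec (z j) = μ ξ j • z j := by
    intro ξ
    ext r
    have := sum_fin_folded_sin n m (by omega) ξ _ hreflect r
    simp only [Matrix.mulVec, dotProduct, Pi.smul_apply, smul_eq_mul, hC, hz, hμ]
    have hs : ∀ k : ℕ, ((j : ℝ) - 1 / 2) * π * ((k : ℝ) + 1 / 2) * h
        = (k + 1 / 2) * (((j : ℝ) - 1 / 2) * π * h) := fun k => by ring
    have hc : ∀ l : ℕ, (l : ℝ) * ((j : ℝ) - 1 / 2) * π * h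
        = l * (((j : ℝ) - 1 / 2) * π * h) := fun l => by ring
    simpa only [hs, hc] using this
  have hz0 : z j ≠ 0 := by
    intro h0
    have h1 := congrFun h0 ⟨0, by omega⟩
    rw [hz] at h1
    refine (sin_pos_of_pos_of_lt_pi ?_ ?_).ne' h1
    · have : 0 < (j : ℝ) - 1 / 2 := by linarith
      rw [hh]
      simp only [Nat.cast_zero]
      positivity
    · rw [hh]
      have e : ((j : ℝ) - 1 / 2) * π * (((0 : ℕ) : ℝ) + 1 / 2) * (1 / n)
          = ((j - 1 / 2) / (2 * n)) * π := by
        push_cast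
        field_simp
        ring
      have : ((j : ℝ) - 1 / 2) / (2 * n) < 1 := by
        rw [div_lt_one (by positivity)]
        linarith
      refine e.trans_lt ?_
      nlinarith [pi_pos]
  have hμ0 : μ β j ≠ 0 := by
    intro h0
    apply hz0
    have h1 := eig β
    rw [h0, zero_smul] at h1
    rw [← Matrix.one_mulVec (z j), ← invOf_mul_self (C β), ← Matrix.mulVec_mulVec, h1,
      Matrix.mulVec_zero]
  refine ⟨hμ0, ?_⟩
  rw [eig, eig, smul_smul, div_mul_cancel₀ _ hμ0]
end

section
/- Assume there is a real ρ > 0 with α_l > 0 and α̂_l = ρ²·α_l for every odd l with 1 ≤ l ≤ m (i.e. the ratios α̂_l/α_l agree for all odd l ≤ m). Then for every j ∈ {1,…,n}, the vector x_j with entries x_{j,k} = sin(j·π·k·h) for odd k and x_{j,k} = ρ·sin(j·π·k·h) for even k, where h = 1/(n+1), satisfies G(α, α̂)·x_j = λ_j·x_j, with λ_j = α_0 + 2·Σ_{odd l, 1 ≤ l ≤ m} √(α_l·α̂_l)·cos(l·j·π·h) + 2·Σ_{even l, 2 ≤ l ≤ m} α_l·cos(l·j·π·h); that is, (λ_j,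 x_j) is an eigenpair of the generalized banded matrix G(α, α̂) with alternating row patterns. -/
open Real Matrix

/-- A sum over the window `-n, …, 2n + 1` of a function vanishing at `0` and `n + 1`, folded by the
reflections about `0` and `n + 1`. -/
lemma sum_fold_reflections (n : ℕ) (f : ℤ → ℝ) (h0 : f 0 = 0) (h1 : f (n + 1) = 0) :
    ∑ i ∈ Finset.range (n + 1 + n + 1 + n), f (-n + i) =
      ∑ i ∈ Finset.range n, (f (i + 1) + f (-(i + 1)) + f (2 * n + 1 - i)) := by
  rw [Finset.sum_range_add, Finset.sum_range_succ, Finset.sum_range_add, Finset.sum_range_succ,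
    ← Finset.sum_range_reflect (fun i : ℕ => f (-n + i)) n,
    ← Finset.sum_range_reflect (fun i : ℕ => f (-n + (n + 1 + n + 1 + i : ℕ))) n,
    Finset.sum_add_distrib, Finset.sum_add_distrib]
  have e1 : f (-n + (n : ℕ)) = 0 := by simpa using h0
  have e2 : f (-n + (n + 1 + n : ℕ)) = 0 := by
    rw [← h1]; congr 1; push_cast; ring
  have e3 : ∑ i ∈ Finset.range n, f (-n + (n - 1 - i : ℕ)) =
      ∑ i ∈ Finset.range n, f (-(i + 1)) :=
    Finset.sum_congr rfl fun i hi => by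
      have := Finset.mem_range.mp hi
      congr 1; omega
  have e4 : ∑ i ∈ Finset.range n, f (-n + (n + 1 + i : ℕ)) =
      ∑ i ∈ Finset.range n, f (i + 1) :=
    Finset.sum_congr rfl fun i _ => by congr 1; push_cast; ring
  have e5 : ∑ i ∈ Finset.range n, f (-n + (n + 1 + n + 1 + (n - 1 - i) : ℕ)) =
      ∑ i ∈ Finset.range n, f (2 * n + 1 - i) :=
    Finset.sum_congr rfl fun i hi => by
      have := Finset.mem_range.mp hi
      congr 1; omega
  rw [e1, e2, e3, e4, e5]
  ring

/-- A sum over a window containing the support `[a - m, a + m]` of `f`, written around the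
centre `a`. -/
lemma sum_window_eq_centered (A B m : ℕ) (s a : ℤ) (f : ℤ → ℝ) (hs : s + A + m = a)
    (hf : ∀ k : ℤ, m < (a - k).natAbs → f k = 0) :
    ∑ i ∈ Finset.range (A + m + 1 + m + B), f (s + i) =
      f a + ∑ l ∈ Finset.Icc 1 m, (f (a + l) + f (a - l)) := by
  have e0 : ∑ l ∈ Finset.Icc 1 m, (f (a + l) + f (a - l)) =
      ∑ i ∈ Finset.range m, (f (a + (i + 1 : ℕ)) + f (a - (i + 1 : ℕ))) := by
    rw [Finset.range_eq_Ico,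
      Finset.sum_Ico_add' (fun l : ℕ => f (a + l) + f (a - l)) 0 m 1]
    rfl
  rw [e0, Finset.sum_range_add, Finset.sum_range_add, Finset.sum_range_succ, Finset.sum_range_add,
    ← Finset.sum_range_reflect (fun i : ℕ => f (s + (A + i : ℕ))) m, Finset.sum_add_distrib]
  have e1 : ∑ i ∈ Finset.range A, f (s + i) = 0 :=
    Finset.sum_eq_zero fun i hi => hf _ (by have := Finset.mem_range.mp hi; omega)
  have e2 : ∑ i ∈ Finset.range B, f (s + (A + m + 1 + m + i : ℕ)) = 0 :=
    Finset.sum_eq_zero fun i _ => hf _ (by omega)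
  have e3 : f (s + (A + m : ℕ)) = f a := by congr 1; omega
  have e4 : ∑ i ∈ Finset.range m, f (s + (A + (m - 1 - i) : ℕ)) =
      ∑ i ∈ Finset.range m, f (a - (i + 1 : ℕ)) :=
    Finset.sum_congr rfl fun i hi => by
      have := Finset.mem_range.mp hi
      congr 1; omega
  have e5 : ∑ i ∈ Finset.range m, f (s + (A + m + 1 + i : ℕ)) =
      ∑ i ∈ Finset.range m, f (a + (i + 1 : ℕ)) :=
    Finset.sum_congr rfl fun i _ => by congr 1; omega
  rw [e1, e2, e3, e4, e5]
  ring

/-- Generalised banded matrix `G(α, α̂)` with alternating row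
patterns. With `μ(r,l) = α_l` for even `l ≤ m`, `μ(r,l) = α_l` (odd `l ≤ m`, odd
1-based row `r`), `μ(r,l) = α̂_l` (odd `l ≤ m`, even row `r`), `μ(r,l) = 0` for
`l > m`, the matrix has 1-based entries
`G_{r,c} = μ(r,|r−c|) − μ(r,r+c) − μ(r,2(n+1)−r−c)`. If there is `ρ > 0` with
`α_l > 0` and `α̂_l = ρ²·α_l` for every odd `l ≤ m`, then for every
`j ∈ {1,…,n}` the vector `x_j` with `x_{j,k} = sin(j·π·k·h)` for odd `k` and
`x_{j,k} = ρ·sin(j·π·k·h)` for even `k` (`h = 1/(n+1)`) is an eigenvector of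
`G(α, α̂)` with eigenvalue
`λ_j = α_0 + 2·Σ_{odd l ≤ m} √(α_l·α̂_l)·cos(l·j·π·h) + 2·Σ_{even l, 2 ≤ l ≤ m} α_l·cos(l·j·π·h)`.
Rows/columns of `G` and entries of `x_j` are 0-based (1-based index = 0-based + 1). -/
theorem stmt13 (n m : ℕ) (hn : 4 ≤ n) (hm2 : 2 ≤ m) (hmn : m ≤ n - 2)
    (α : ℕ → ℝ) (αh : ℕ → ℝ)
    (ρ : ℝ) (hρ : 0 < ρ)
    (hodd : ∀ l : ℕ, l % 2 = 1 → 1 ≤ l → l ≤ m → 0 < α l ∧ αh l = ρ ^ 2 * α l)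
    (h : ℝ) (hh : h = 1 / (n + 1))
    (μ : ℕ → ℕ → ℝ)
    (hμ : ∀ r l : ℕ, μ r l =
      if l ≤ m then (if l % 2 = 0 then α l else (if r % 2 = 1 then α l else αh l)) else 0)
    (G : Matrix (Fin n) (Fin n) ℝ)
    (hG : ∀ r c : Fin n, G r c =
      μ ((r : ℕ) + 1) (((r : ℤ) - (c : ℤ)).natAbs)
      - μ ((r : ℕ) + 1) ((r : ℕ) + (c : ℕ) + 2)
      - μ ((r : ℕ) + 1) (2 * n - (r : ℕ) - (c : ℕ)))
    (x : ℕ → Fin n → ℝ)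
    (hx : ∀ (j : ℕ) (k : Fin n), x j k =
      (if (k : ℕ) % 2 = 0 then 1 else ρ) * Real.sin (j * π * ((k : ℝ) + 1) * h))
    (lam : ℕ → ℝ)
    (hlam : ∀ j : ℕ, lam j = α 0
      + 2 * ∑ l ∈ (Finset.Icc 1 m).filter (fun l => l % 2 = 1),
          Real.sqrt (α l * αh l) * Real.cos (l * j * π * h)
      + 2 * ∑ l ∈ (Finset.Icc 2 m).filter (fun l => l % 2 = 0),
          α l * Real.cos (l * j * π * h)) :
    ∀ j : ℕ, 1 ≤ j → j ≤ n → G.mulVec (x j) = lam j • x j := by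
  intro j _ _
  ext r
  obtain ⟨θ, hθ⟩ : ∃ θ : ℝ, θ = j * π * h := ⟨_, rfl⟩
  have hθn : θ * (n + 1) = j * π := by
    have : (n : ℝ) + 1 ≠ 0 := by positivity
    rw [hθ, hh]; field_simp
  obtain ⟨w, hw⟩ : ∃ w : ℤ → ℝ, ∀ k, w k = if k % 2 = 1 then 1 else ρ := ⟨_, fun _ => rfl⟩
  obtain ⟨X, hX⟩ : ∃ X : ℤ → ℝ, ∀ k, X k = w k * Real.sin (k * θ) := ⟨_, fun _ => rfl⟩
  have hxX : ∀ k : Fin n, x j k = X ((k : ℕ) + 1) := fun k => by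
    rw [hx, hX, hw, hθ]
    have hk : (((k : ℕ) : ℤ) + 1) % 2 = 1 ↔ (k : ℕ) % 2 = 0 := by omega
    simp only [hk]
    congr 2
    push_cast; ring
  have hX_neg : ∀ k : ℤ, X (-k) = -X k := fun k => by
    have hk : (-k) % 2 = 1 ↔ k % 2 = 1 := by omega
    simp only [hX, hw, hk]
    push_cast
    rw [neg_mul, Real.sin_neg]; ring
  have hX_reflect : ∀ k : ℤ, X (2 * (n + 1) - k) = -X k := fun k => by
    have hk : (2 * ((n : ℤ) + 1) - k) % 2 = 1 ↔ k % 2 = 1 := by omega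
    simp only [hX, hw, hk]
    have harg : ((2 * ((n : ℤ) + 1) - k : ℤ) : ℝ) * θ = (j : ℕ) * (2 * π) - k * θ := by
      push_cast; linear_combination 2 * hθn
    rw [harg, Real.sin_nat_mul_two_pi_sub]; ring
  have hX0 : X 0 = 0 := by simp [hX]
  have hXn : X (n + 1) = 0 := by
    have := hX_reflect (n + 1)
    rw [show 2 * ((n : ℤ) + 1) - (n + 1) = n + 1 by ring] at this
    linarith
  obtain ⟨f, hf⟩ : ∃ f : ℤ → ℝ, ∀ k, f k = μ (r + 1) (((r : ℤ) + 1 - k).natAbs) * X k :=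
    ⟨_, fun _ => rfl⟩
  have hr := r.isLt
  have hmul : (G.mulVec (x j)) r =
      ∑ i ∈ Finset.range n, (f (i + 1) + f (-(i + 1)) + f (2 * n + 1 - i)) := by
    rw [Finset.sum_range, Matrix.mulVec, dotProduct]
    refine Finset.sum_congr rfl fun c _ => ?_
    have hc := c.isLt
    have e1 : ((r : ℤ) + 1 - ((c : ℕ) + 1)).natAbs = ((r : ℤ) - (c : ℤ)).natAbs := by omega
    have e2 : ((r : ℤ) + 1 - -(((c : ℕ) : ℤ) + 1)).natAbs = (r : ℕ) + (c : ℕ) + 2 := by omega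
    have e3 : ((r : ℤ) + 1 - (2 * n + 1 - (c : ℕ))).natAbs = 2 * n - (r : ℕ) - (c : ℕ) := by omega
    have e4 : X (2 * n + 1 - (c : ℕ)) = -X ((c : ℕ) + 1) := by
      rw [← hX_reflect]; congr 1; ring
    rw [hf, hf, hf, e1, e2, e3, e4, hX_neg, hG, hxX]
    ring
  obtain ⟨A, hA⟩ : ∃ A, A + m = r + 1 + n := ⟨r + 1 + n - m, by omega⟩
  obtain ⟨B, hB⟩ : ∃ B, A + m + 1 + m + B = n + 1 + n + 1 + n :=
    ⟨n + 1 + n + 1 + n - (A + m + 1 + m), by omega⟩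
  rw [hmul, ← sum_fold_reflections n f (by rw [hf, hX0, mul_zero]) (by rw [hf, hXn, mul_zero]), ← hB,
    sum_window_eq_centered A B m (-n) (r + 1) f (by omega) (fun k hk => by
      rw [hf, hμ, if_neg (by omega), zero_mul])]
  have hterm : ∀ l ∈ Finset.Icc 1 m, f ((r : ℤ) + 1 + l) + f ((r : ℤ) + 1 - l) =
      2 * ((if l % 2 = 1 then Real.sqrt (α l * αh l) * Real.cos (l * j * π * h)
        else α l * Real.cos (l * j * π * h)) * X (r + 1)) := fun l hl => by
    obtain ⟨hl1, hlm⟩ := Finset.mem_Icc.mp hl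
    have e1 : ((r : ℤ) + 1 - (r + 1 + l)).natAbs = l := by omega
    have e2 : ((r : ℤ) + 1 - (r + 1 - l)).natAbs = l := by omega
    have hcos : (l : ℝ) * j * π * h = l * θ := by rw [hθ]; ring
    have hwl : w (r + 1 - l) = w (r + 1 + l) := by
      have hk : ((r : ℤ) + 1 - l) % 2 = 1 ↔ ((r : ℤ) + 1 + l) % 2 = 1 := by omega
      simp only [hw, hk]
    have hcoef : μ (r + 1) l * w (r + 1 + l) =
        (if l % 2 = 1 then Real.sqrt (α l * αh l) else α l) * w (r + 1) := by
      rw [hμ, if_pos hlm, hw, hw]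
      rcases Nat.mod_two_eq_zero_or_one l with h2 | h2
      · have hk : ((r : ℤ) + 1 + l) % 2 = 1 ↔ ((r : ℤ) + 1) % 2 = 1 := by omega
        simp [h2, hk]
      · obtain ⟨hpos, hαh⟩ := hodd l h2 hl1 hlm
        have hsqrt : Real.sqrt (α l * αh l) = ρ * α l := by
          rw [hαh, show α l * (ρ ^ 2 * α l) = (ρ * α l) ^ 2 by ring]
          exact Real.sqrt_sq (by positivity)
        rw [hsqrt, if_neg (by omega : ¬ l % 2 = 0), if_pos h2, hαh]
        by_cases h3 : ((r : ℕ) + 1) % 2 = 1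
        · rw [if_pos h3, if_neg (by omega), if_pos (by omega)]; ring
        · rw [if_neg h3, if_pos (by omega), if_neg (by omega)]; ring
    have hsin : Real.sin (((r : ℤ) + 1 + l : ℤ) * θ) + Real.sin (((r : ℤ) + 1 - l : ℤ) * θ) =
        2 * (Real.sin (((r : ℤ) + 1 : ℤ) * θ) * Real.cos (l * θ)) := by
      push_cast
      rw [add_mul _ (l : ℝ), sub_mul _ (l : ℝ), Real.sin_add, Real.sin_sub]; ring
    rw [hf, hf, e1, e2, hX, hX, hX, hwl, hcos, ← ite_mul]
    linear_combination (μ (r + 1) l * w (r + 1 + l)) * hsin +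
      2 * (Real.sin (((r : ℤ) + 1 : ℤ) * θ) * Real.cos (l * θ)) * hcoef
  have hcenter : f (r + 1) = α 0 * X (r + 1) := by
    rw [hf, hμ]; simp
  have heven : (Finset.Icc 2 m).filter (fun l => l % 2 = 0) =
      (Finset.Icc 1 m).filter (fun l => ¬ l % 2 = 1) := by
    ext l; simp only [Finset.mem_filter, Finset.mem_Icc]; omega
  rw [Finset.sum_congr rfl hterm, ← Finset.mul_sum, ← Finset.sum_mul, Finset.sum_ite, hcenter,
    Pi.smul_apply, smul_eq_mul, hlam, hxX, heven]
  ring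
end
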